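/- Let Ω ⊂ R^N, N ≥ 2, be an open set, p ∈ (1,p_N) (p_N = +∞ if N=2, N/(N−2) if N ≥ 3), and let w_n be a sequence of classical solutions of −Δw_n = [w_n−1]_+^p in Ω with ‖[w_n]_−‖_{L¹(Ω)} ≤ C for all n. Then the negative parts [w_n]_− are locally uniformly bounded, and there exists a subsequence (still denoted w_n) such that either (i) w_n → +∞ locally uniformly in Ω, or (ii) w_n → w in C²_loc(Ω). Moreover (ii) occurs if and only if [w_n−1]_+^p is bounded in L¹_loc(Ω). -/

import Mathlib

open MeasureTheory Metric Filter Real Set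
noncomputable section

/-- The Laplacian of `f : ℝᴺ → ℝ` as the sum of second partial derivatives. -/
def lap {N : ℕ} (f : EuclideanSpace ℝ (Fin N) → ℝ) (x : EuclideanSpace ℝ (Fin N)) : ℝ :=
  ∑ i : Fin N, fderiv ℝ (fun y => fderiv ℝ f y (EuclideanSpace.single i 1)) x
    (EuclideanSpace.single i 1)

theorem exists_radial_kernel (N : ℕ) (hN : 2 ≤ N) :
    ∃ G ψ : EuclideanSpace ℝ (Fin N) → ℝ, ContDiff ℝ 2 G ∧ ContDiff ℝ 2 ψ ∧
      (∀ z, 0 ≤ G z) ∧ (∀ z, 0 ≤ ψ z) ∧ (∀ z, 1 ≤ ‖z‖ → G z = 0) ∧ (∀ z, 1 ≤ ‖z‖ → ψ z = 0) ∧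
      HasCompactSupport G ∧ HasCompactSupport ψ ∧
      (∀ z v, fderiv ℝ G z v = -(ψ z * inner ℝ z v)) ∧ 0 < ∫ z, ψ z := by
  have he : ContDiff ℝ 3 expNegInvGlue := expNegInvGlue.contDiff (n := 3)
  have hd : ContDiff ℝ 2 (deriv expNegInvGlue) := by
    have : ContDiff ℝ (2 + 1) expNegInvGlue := by norm_num; exact he
    exact (contDiff_succ_iff_deriv.1 this).2.2
  have hsq : ContDiff ℝ 3 (fun z : EuclideanSpace ℝ (Fin N) => 1 - ‖z‖ ^ 2) :=
    contDiff_const.sub (contDiff_norm_sq ℝ)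
  set G : EuclideanSpace ℝ (Fin N) → ℝ := fun z => expNegInvGlue (1 - ‖z‖ ^ 2) with hG
  set ψ : EuclideanSpace ℝ (Fin N) → ℝ := fun z => 2 * deriv expNegInvGlue (1 - ‖z‖ ^ 2) with hψ
  have hGc : ContDiff ℝ 2 G := (he.comp hsq).of_le (by norm_num)
  have hψc : ContDiff ℝ 2 ψ := contDiff_const.mul (hd.comp (hsq.of_le (by norm_num)))
  have hnn : ∀ s, 0 ≤ deriv expNegInvGlue s := fun s => expNegInvGlue.monotone.deriv_nonneg
  have hz : ∀ s ≤ 0, deriv expNegInvGlue s = 0 := by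
    have : Set.EqOn (deriv expNegInvGlue) 0 (closure (Iio 0)) := by
      apply Set.EqOn.closure _ hd.continuous continuous_zero
      intro s hs
      have : expNegInvGlue =ᶠ[nhds s] fun _ => 0 := by
        filter_upwards [Iio_mem_nhds hs] with y hy
        exact expNegInvGlue.zero_of_nonpos (le_of_lt hy)
      rw [this.deriv_eq]; simp
    intro s hs
    exact this (by rw [closure_Iio]; exact hs)
  have hG0 : ∀ z, 1 ≤ ‖z‖ → G z = 0 := fun z h => 
    expNegInvGlue.zero_of_nonpos (by nlinarith)
  have hψ0 : ∀ z, 1 ≤ ‖z‖ → ψ z = 0 := fun z h => by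
    simp only [hψ]; rw [hz _ (by nlinarith)]; simp
  have hcs : ∀ F : EuclideanSpace ℝ (Fin N) → ℝ, (∀ z, 1 ≤ ‖z‖ → F z = 0) →
      HasCompactSupport F := fun F hF =>
    HasCompactSupport.intro (isCompact_closedBall 0 1) (fun z hz => hF z (by
      simp at hz; exact hz.le))
  have hfd : ∀ z v, fderiv ℝ G z v = -(ψ z * inner ℝ z v) := by
    intro z v
    have h1 : HasFDerivAt (fun z : EuclideanSpace ℝ (Fin N) => 1 - ‖z‖ ^ 2)
        (-(2 • (innerSL ℝ z))) z := by
      have := (hasStrictFDerivAt_norm_sq z).hasFDerivAt.const_sub (1:ℝ)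
      exact this
    have h2 : HasDerivAt expNegInvGlue (deriv expNegInvGlue (1 - ‖z‖ ^ 2)) (1 - ‖z‖ ^ 2) :=
      ((he.differentiable (by norm_num)) _).hasDerivAt
    have := (h2.comp_hasFDerivAt z h1).fderiv
    simp only [hG, hψ]
    rw [show (fun z : EuclideanSpace ℝ (Fin N) => expNegInvGlue (1 - ‖z‖ ^ 2)) =
      expNegInvGlue ∘ fun z => 1 - ‖z‖ ^ 2 from rfl, this]
    simp
    ring
  refine ⟨G, ψ, hGc, hψc, fun z => expNegInvGlue.nonneg _, fun z => mul_nonneg zero_le_two (hnn _),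
    hG0, hψ0, hcs G hG0, hcs ψ hψ0, hfd, ?_⟩
  have hex : ∃ z, ψ z ≠ 0 := by
    by_contra! h
    have hconst := is_const_of_fderiv_eq_zero (𝕜 := ℝ) (hGc.differentiable (by norm_num))
      (fun z => by ext v; rw [hfd, h]; simp) 0 (EuclideanSpace.single ⟨0, by omega⟩ 1)
    rw [hG0 (EuclideanSpace.single _ _) (by simp)] at hconst
    simp only [hG] at hconst
    have := expNegInvGlue.pos_of_pos (x := 1) one_pos
    simp at hconst
    linarith
  obtain ⟨z, hz⟩ := hex
  exact hψc.continuous.integral_pos_of_hasCompactSupport_nonneg_nonzero (hcs ψ hψ0)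
    (fun z => mul_nonneg zero_le_two (hnn _)) hz


section KernelIdentities

variable {N : ℕ}

theorem hasDerivAt_integral_mul_comp_add_smul {K h : EuclideanSpace ℝ (Fin N) → ℝ}
    (hK : Continuous K) (hKc : HasCompactSupport K) (hh : ContDiff ℝ 1 h)
    (x : EuclideanSpace ℝ (Fin N)) (s : ℝ) :
    HasDerivAt (fun s : ℝ => ∫ z, K z * h (x + s • z))
      (∫ z, K z * fderiv ℝ h (x + s • z) z) s := by
  have hdc : Continuous (fderiv ℝ h) := hh.continuous_fderiv (by norm_num)
  have hcont : Continuous (fun q : ℝ × EuclideanSpace ℝ (Fin N) =>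
      K q.2 * fderiv ℝ h (x + q.1 • q.2) q.2) := by fun_prop
  obtain ⟨B, hB⟩ := ((isCompact_closedBall s 1).prod hKc).exists_bound_of_continuousOn
    hcont.continuousOn
  have hInt : ∀ F : EuclideanSpace ℝ (Fin N) → ℝ, Continuous F →
      Integrable (fun z => K z * F z) := fun F hF =>
    (hK.mul hF).integrable_of_hasCompactSupport hKc.mul_right
  have hb : Integrable ((tsupport K).indicator fun _ => B) :=
    (integrable_indicator_iff hKc.isClosed.measurableSet).2
      (integrableOn_const hKc.measure_lt_top.ne)
  refine (hasDerivAt_integral_of_dominated_loc_of_deriv_le (s := ball s 1)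
    (F' := fun s z => K z * fderiv ℝ h (x + s • z) z)
    (ball_mem_nhds s one_pos) (Eventually.of_forall fun t => ?_) ?_ ?_ ?_ hb ?_).2
  · exact (hInt _ (hh.continuous.comp (by fun_prop))).aestronglyMeasurable
  · exact hInt _ (hh.continuous.comp (by fun_prop))
  · exact (hInt _ (by fun_prop)).aestronglyMeasurable
  · refine Eventually.of_forall fun z t ht => ?_
    by_cases hz : z ∈ tsupport K
    · rw [indicator_of_mem hz]
      exact hB (t, z) ⟨ball_subset_closedBall ht, hz⟩
    · rw [indicator_of_notMem hz, image_eq_zero_of_notMem_tsupport hz]; simp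
  · refine Eventually.of_forall fun z t _ => ?_
    have h1 : HasDerivAt (fun t : ℝ => x + t • z) z t := by
      simpa using ((hasDerivAt_id t).smul_const z).const_add x
    have h2 := ((hh.differentiable (by norm_num)) (x + t • z)).hasFDerivAt
    exact (h2.comp_hasDerivAt t h1).const_mul (K z)

theorem integral_fderiv_mul_comp_add_smul {K h : EuclideanSpace ℝ (Fin N) → ℝ}
    (hK : ContDiff ℝ 1 K) (hKc : HasCompactSupport K) (hh : ContDiff ℝ 1 h)
    (x e : EuclideanSpace ℝ (Fin N)) (s : ℝ) :
    ∫ z, fderiv ℝ K z e * h (x + s • z) = -(s * ∫ z, K z * fderiv ℝ h (x + s • z) e) := by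
  have hdc : Continuous (fderiv ℝ h) := hh.continuous_fderiv (by norm_num)
  have hkc : Continuous (fderiv ℝ K) := hK.continuous_fderiv (by norm_num)
  have hfd : ∀ z, fderiv ℝ (fun z => h (x + s • z)) z e = s * fderiv ℝ h (x + s • z) e := by
    intro z
    have h1 : HasFDerivAt (fun z : EuclideanSpace ℝ (Fin N) => x + s • z)
        (s • ContinuousLinearMap.id ℝ _) z :=
      ((hasFDerivAt_id z).const_smul s).const_add x
    have h2 := ((hh.differentiable (by norm_num)) (x + s • z)).hasFDerivAt
    have h3 := (h2.comp z h1).fderiv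
    rw [show (fun z => h (x + s • z)) = h ∘ fun z => x + s • z from rfl, h3]
    simp
  have hcomp : ContDiff ℝ 1 (fun z => h (x + s • z)) := hh.comp (by fun_prop)
  have hc1 : Continuous (fun z => h (x + s • z)) := hcomp.continuous
  have key := integral_mul_fderiv_eq_neg_fderiv_mul_of_integrable (μ := volume)
    (f := K) (g := fun z => h (x + s • z)) (v := e) ?_ ?_ ?_
    (fun z _ => hK.differentiable (by norm_num) z)
    (fun z _ => hcomp.differentiable (by norm_num) z)
  · rw [← neg_eq_iff_eq_neg.2 key, ← integral_const_mul]
    congr 1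
    congr 1
    ext z
    rw [hfd]; ring
  · refine Continuous.integrable_of_hasCompactSupport (by fun_prop) ?_
    exact (hKc.fderiv_apply (𝕜 := ℝ) e).mul_right
  · simp_rw [hfd]
    exact Continuous.integrable_of_hasCompactSupport
      (hK.continuous.mul (by fun_prop)) hKc.mul_right
  · exact (hK.continuous.mul hc1).integrable_of_hasCompactSupport hKc.mul_right

theorem ContDiff.fderiv_apply_one {u : EuclideanSpace ℝ (Fin N) → ℝ} (hu : ContDiff ℝ 2 u)
    (e : EuclideanSpace ℝ (Fin N)) : ContDiff ℝ 1 (fun y => fderiv ℝ u y e) :=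
  (hu.fderiv_right (m := 1) (by norm_num)).clm_apply contDiff_const

theorem ContDiff.continuous_lap {u : EuclideanSpace ℝ (Fin N) → ℝ} (hu : ContDiff ℝ 2 u) :
    Continuous (lap u) :=
  continuous_finsetSum _ fun i _ =>
    ((hu.fderiv_apply_one (EuclideanSpace.single i 1)).continuous_fderiv
      (by norm_num)).clm_apply continuous_const

theorem sum_integral_fderiv_mul_fderiv {K u : EuclideanSpace ℝ (Fin N) → ℝ}
    (hK : ContDiff ℝ 1 K) (hKc : HasCompactSupport K) (hu : ContDiff ℝ 2 u)
    (x : EuclideanSpace ℝ (Fin N)) (s : ℝ) :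
    ∑ i, ∫ z, fderiv ℝ K z (EuclideanSpace.single i 1) *
        fderiv ℝ u (x + s • z) (EuclideanSpace.single i 1) =
      -(s * ∫ z, K z * lap u (x + s • z)) := by
  simp_rw [fun i => integral_fderiv_mul_comp_add_smul hK hKc
    (hu.fderiv_apply_one (EuclideanSpace.single i 1)) x (EuclideanSpace.single i 1) s]
  rw [Finset.sum_neg_distrib, ← Finset.mul_sum, ← integral_finsetSum]
  · simp_rw [← Finset.mul_sum]; rfl
  · intro i _
    refine Continuous.integrable_of_hasCompactSupport (hK.continuous.mul ?_) hKc.mul_right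
    exact (((hu.fderiv_apply_one (EuclideanSpace.single i 1)).continuous_fderiv
      (by norm_num)).comp (by fun_prop)).clm_apply continuous_const

theorem clm_apply_eq_sum (L : EuclideanSpace ℝ (Fin N) →L[ℝ] ℝ) (z : EuclideanSpace ℝ (Fin N)) :
    L z = ∑ i, z i * L (EuclideanSpace.single i 1) := by
  conv_lhs => rw [← (EuclideanSpace.basisFun (Fin N) ℝ).sum_repr z]
  simp

variable {G ψ : EuclideanSpace ℝ (Fin N) → ℝ}

theorem integral_mul_fderiv_radial (hG : ContDiff ℝ 2 G) (hGc : HasCompactSupport G)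
    (hGψ : ∀ z v, fderiv ℝ G z v = -(ψ z * inner ℝ z v)) {h : EuclideanSpace ℝ (Fin N) → ℝ}
    (hh : ContDiff ℝ 1 h) (x : EuclideanSpace ℝ (Fin N)) (s : ℝ) :
    ∫ z, ψ z * fderiv ℝ h (x + s • z) z =
      -∑ i, ∫ z, fderiv ℝ G z (EuclideanSpace.single i 1) *
        fderiv ℝ h (x + s • z) (EuclideanSpace.single i 1) := by
  have hdc : Continuous (fderiv ℝ h) := hh.continuous_fderiv (by norm_num)
  have hkc : Continuous (fderiv ℝ G) := hG.continuous_fderiv (by norm_num)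
  rw [← integral_finsetSum, ← integral_neg]
  · congr 1
    ext z
    rw [clm_apply_eq_sum, Finset.mul_sum, ← Finset.sum_neg_distrib]
    refine Finset.sum_congr rfl fun i _ => ?_
    rw [hGψ, EuclideanSpace.inner_single_right]
    simp; ring
  · intro i _
    exact Continuous.integrable_of_hasCompactSupport (by fun_prop)
      (hGc.fderiv_apply (𝕜 := ℝ) _).mul_right

theorem integral_mul_fderiv_radial_eq_lap (hG : ContDiff ℝ 2 G) (hGc : HasCompactSupport G)
    (hGψ : ∀ z v, fderiv ℝ G z v = -(ψ z * inner ℝ z v)) {u : EuclideanSpace ℝ (Fin N) → ℝ}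
    (hu : ContDiff ℝ 2 u) (x : EuclideanSpace ℝ (Fin N)) (s : ℝ) :
    ∫ z, ψ z * fderiv ℝ u (x + s • z) z = s * ∫ z, G z * lap u (x + s • z) := by
  rw [integral_mul_fderiv_radial hG hGc hGψ (hu.of_le (by norm_num)),
    sum_integral_fderiv_mul_fderiv (hG.of_le (by norm_num)) hGc hu, neg_neg]

theorem fderiv_fderiv_apply_comm {u : EuclideanSpace ℝ (Fin N) → ℝ} (hu : ContDiff ℝ 2 u)
    (y v e : EuclideanSpace ℝ (Fin N)) :
    fderiv ℝ (fun y => fderiv ℝ u y v) y e = fderiv ℝ (fun y => fderiv ℝ u y e) y v := by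
  have hd : DifferentiableAt ℝ (fderiv ℝ u) y :=
    (hu.fderiv_right (m := 1) (by norm_num)).differentiable (by norm_num) y
  have hs : IsSymmSndFDerivAt ℝ u y := hu.contDiffAt.isSymmSndFDerivAt (by simp)
  rw [fderiv_clm_apply hd (differentiableAt_const v), fderiv_clm_apply hd (differentiableAt_const e)]
  simp
  exact hs e v

theorem integral_mul_fderiv_fderiv_radial_eq_lap (hG : ContDiff ℝ 2 G) (hGc : HasCompactSupport G)
    (hGψ : ∀ z v, fderiv ℝ G z v = -(ψ z * inner ℝ z v)) {u : EuclideanSpace ℝ (Fin N) → ℝ}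
    (hu : ContDiff ℝ 2 u) (x v : EuclideanSpace ℝ (Fin N)) {s : ℝ} (hs : s ≠ 0) :
    ∫ z, ψ z * fderiv ℝ (fun y => fderiv ℝ u y v) (x + s • z) z =
      -∫ z, fderiv ℝ G z v * lap u (x + s • z) := by
  rw [integral_mul_fderiv_radial hG hGc hGψ (hu.fderiv_apply_one v)]
  apply mul_left_cancel₀ hs
  have h1 : ∀ i, s * ∫ z, fderiv ℝ G z (EuclideanSpace.single i 1) *
        fderiv ℝ (fun y => fderiv ℝ u y v) (x + s • z) (EuclideanSpace.single i 1) =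
      - ∫ z, fderiv ℝ (fun z => fderiv ℝ G z v) z (EuclideanSpace.single i 1) *
        fderiv ℝ u (x + s • z) (EuclideanSpace.single i 1) := by
    intro i
    simp_rw [fderiv_fderiv_apply_comm hu _ v, fderiv_fderiv_apply_comm hG _ v]
    rw [integral_fderiv_mul_comp_add_smul (hG.fderiv_apply_one _) (hGc.fderiv_apply (𝕜 := ℝ) _)
      (hu.fderiv_apply_one _), neg_neg]
  rw [mul_neg, Finset.mul_sum]
  simp_rw [h1]
  rw [Finset.sum_neg_distrib, sum_integral_fderiv_mul_fderiv (hG.fderiv_apply_one v)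
    (hGc.fderiv_apply (𝕜 := ℝ) _) hu]
  ring

end KernelIdentities


section LocalEstimates

variable {N : ℕ} {G ψ : EuclideanSpace ℝ (Fin N) → ℝ}

theorem add_smul_mem_closedBall {x z : EuclideanSpace ℝ (Fin N)} {s t : ℝ} (hs : 0 ≤ s)
    (hst : s ≤ t) (hz : ‖z‖ ≤ 1) : x + s • z ∈ closedBall x t := by
  rw [mem_closedBall, dist_eq_norm, add_sub_cancel_left, norm_smul, Real.norm_of_nonneg hs]
  nlinarith [norm_nonneg z]

theorem integral_radial_mul_le_of_lap_ge (hG : ContDiff ℝ 2 G) (hGc : HasCompactSupport G)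
    (hG0 : ∀ z, 0 ≤ G z) (hG1 : ∀ z, 1 ≤ ‖z‖ → G z = 0)
    (hψ : ContDiff ℝ 2 ψ) (hψc : HasCompactSupport ψ)
    (hGψ : ∀ z v, fderiv ℝ G z v = -(ψ z * inner ℝ z v)) {u : EuclideanSpace ℝ (Fin N) → ℝ}
    (hu : ContDiff ℝ 2 u) {x : EuclideanSpace ℝ (Fin N)} {t A : ℝ} (ht : 0 < t) (hA : 0 ≤ A)
    (hlap : ∀ y ∈ closedBall x t, -A ≤ lap u y) :
    (∫ z, ψ z) * u x ≤ (∫ z, ψ z * u (x + t • z)) + A * t ^ 2 * ∫ z, G z := by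
  have hd := hasDerivAt_integral_mul_comp_add_smul hψ.continuous hψc
    (hu.of_le (by norm_num : (1 : WithTop ℕ∞) ≤ 2)) x
  obtain ⟨s, ⟨hs0, hst⟩, hs⟩ := exists_hasDerivAt_eq_slope _ _ ht
    (fun s _ => (hd s).continuousAt.continuousWithinAt) (fun s _ => hd s)
  rw [integral_mul_fderiv_radial_eq_lap hG hGc hGψ hu, eq_div_iff (by linarith)] at hs
  have hGint : Integrable G := hG.continuous.integrable_of_hasCompactSupport hGc
  have h1 : -A * ∫ z, G z ≤ ∫ z, G z * lap u (x + s • z) := by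
    rw [← integral_const_mul]
    refine integral_mono (hGint.const_mul _)
      ((hG.continuous.mul (hu.continuous_lap.comp
        (by fun_prop))).integrable_of_hasCompactSupport hGc.mul_right) fun z => ?_
    rcases le_total 1 ‖z‖ with h | h
    · simp [hG1 z h]
    · have := mul_le_mul_of_nonneg_left
        (hlap _ (add_smul_mem_closedBall hs0.le hst.le h)) (hG0 z)
      simp only
      linarith
  have hGi : 0 ≤ ∫ z, G z := integral_nonneg hG0
  simp only [zero_smul, add_zero, integral_mul_const, sub_zero] at hs
  have h2 : -(A * t ^ 2 * ∫ z, G z) ≤ s * (∫ z, G z * lap u (x + s • z)) * t := by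
    have h3 : s * t * (-A * ∫ z, G z) ≤ s * t * ∫ z, G z * lap u (x + s • z) :=
      mul_le_mul_of_nonneg_left h1 (by positivity)
    have h4 : 0 ≤ (t - s) * t * (A * ∫ z, G z) :=
      mul_nonneg (mul_nonneg (by linarith) ht.le) (mul_nonneg hA hGi)
    nlinarith
  linarith

theorem integral_radial_mul_comp_le (hψ : Continuous ψ) (hψc : HasCompactSupport ψ)
    (hψ0 : ∀ z, 0 ≤ ψ z) (hψ1 : ∀ z, 1 ≤ ‖z‖ → ψ z = 0) {S : ℝ} (hS : ∀ z, ψ z ≤ S)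
    {u h : EuclideanSpace ℝ (Fin N) → ℝ} (hu : Continuous u)
    {x : EuclideanSpace ℝ (Fin N)} {t : ℝ} (ht : 0 < t)
    (hInt : IntegrableOn h (closedBall x t)) (hle : ∀ y ∈ closedBall x t, u y ≤ h y)
    (h0 : ∀ y ∈ closedBall x t, 0 ≤ h y) :
    ∫ z, ψ z * u (x + t • z) ≤ S * ((t ^ N)⁻¹ * ∫ y in closedBall x t, h y) := by
  set F := (closedBall x t).indicator h with hF
  have hFint : Integrable F := (integrable_indicator_iff measurableSet_closedBall).2 hInt
  have hF1 : Integrable (fun y => F (x + y)) := hFint.comp_add_left x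
  have hF2 : Integrable (fun z => F (x + t • z)) := hF1.comp_smul ht.ne'
  have heq : ∫ z, F (x + t • z) = (t ^ N)⁻¹ * ∫ y in closedBall x t, h y := by
    have := Measure.integral_comp_smul (volume : Measure (EuclideanSpace ℝ (Fin N)))
      (fun y => F (x + y)) t
    rw [this, integral_add_left_eq_self (μ := volume) F x, hF,
      integral_indicator measurableSet_closedBall, finrank_euclideanSpace_fin,
      abs_of_pos (by positivity), smul_eq_mul]
  rw [← heq, ← integral_const_mul]
  refine integral_mono ((hψ.mul (hu.comp (by fun_prop))).integrable_of_hasCompactSupport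
    hψc.mul_right) (hF2.const_mul S) fun z => ?_
  have hSn : 0 ≤ S := (hψ0 0).trans (hS 0)
  have hFn : ∀ y, 0 ≤ F y := fun y => indicator_nonneg h0 y
  rcases le_total 1 ‖z‖ with h | h
  · simp only [hψ1 z h, zero_mul]
    exact mul_nonneg hSn (hFn _)
  · have hm := add_smul_mem_closedBall (x := x) ht.le le_rfl h
    simp only [hF, indicator_of_mem hm]
    exact (mul_le_mul_of_nonneg_left (hle _ hm) (hψ0 z)).trans
      (mul_le_mul_of_nonneg_right (hS z) (h0 _ hm))

theorem norm_fderiv_apply_le_of_radial (hG : ContDiff ℝ 2 G) (hGc : HasCompactSupport G)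
    (hG1 : ∀ z, 1 ≤ ‖z‖ → G z = 0)
    (hψ : ContDiff ℝ 2 ψ) (hψc : HasCompactSupport ψ) (hψ1 : ∀ z, 1 ≤ ‖z‖ → ψ z = 0)
    (hGψ : ∀ z v, fderiv ℝ G z v = -(ψ z * inner ℝ z v)) {u : EuclideanSpace ℝ (Fin N) → ℝ}
    (hu : ContDiff ℝ 2 u) {x v : EuclideanSpace ℝ (Fin N)} {t M : ℝ} (ht : 0 < t)
    (hub : ∀ y ∈ closedBall x t, |u y| ≤ M) (hlap : ∀ y ∈ closedBall x t, |lap u y| ≤ M) :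
    |(∫ z, ψ z) * fderiv ℝ u x v| ≤
      ((t⁻¹ * ∫ z, ‖fderiv ℝ ψ z‖) + t * ∫ z, ‖fderiv ℝ G z‖) * ‖v‖ * M := by
  have hd := hasDerivAt_integral_mul_comp_add_smul hψ.continuous hψc
    (hu.fderiv_apply_one v) x
  obtain ⟨s, ⟨hs0, hst⟩, hs⟩ := exists_hasDerivAt_eq_slope _ _ ht
    (fun s _ => (hd s).continuousAt.continuousWithinAt) (fun s _ => hd s)
  rw [integral_mul_fderiv_fderiv_radial_eq_lap hG hGc hGψ hu x v hs0.ne',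
    eq_div_iff (by linarith)] at hs
  have hbound : ∀ (K h : EuclideanSpace ℝ (Fin N) → ℝ), ContDiff ℝ 2 K → HasCompactSupport K →
      (∀ z, 1 ≤ ‖z‖ → K z = 0) → (∀ y ∈ closedBall x t, |h y| ≤ M) → ∀ r, 0 ≤ r → r ≤ t →
      |∫ z, fderiv ℝ K z v * h (x + r • z)| ≤ (∫ z, ‖fderiv ℝ K z‖) * ‖v‖ * M := by
    intro K h hK hKc hK1 hh r hr hrt
    have hKd : Continuous (fderiv ℝ K) := hK.continuous_fderiv (by norm_num)
    rw [← integral_mul_const, ← integral_mul_const, ← Real.norm_eq_abs]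
    refine norm_integral_le_of_norm_le ?_ (Eventually.of_forall fun z => ?_)
    · exact ((hKd.norm.integrable_of_hasCompactSupport
        (hKc.fderiv (𝕜 := ℝ)).norm).mul_const _).mul_const _
    · rw [norm_mul]
      rcases le_or_gt ‖z‖ 1 with h1 | h1
      · exact mul_le_mul ((fderiv ℝ K z).le_opNorm v) (hh _ (add_smul_mem_closedBall hr hrt h1))
          (norm_nonneg _) (by positivity)
      · have : K =ᶠ[nhds z] fun _ => 0 := by
          filter_upwards [continuous_norm.continuousAt.eventually (lt_mem_nhds h1)] with y hy
          exact hK1 y hy.le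
        simp [this.fderiv_eq]
  have hibp := integral_fderiv_mul_comp_add_smul (hψ.of_le (by norm_num : (1 : WithTop ℕ∞) ≤ 2))
    hψc (hu.of_le (by norm_num)) x v t
  have hb1 := hbound ψ u hψ hψc hψ1 hub t ht.le le_rfl
  have hb2 := hbound G (lap u) hG hGc hG1 hlap s hs0.le hst.le
  simp only [zero_smul, add_zero, integral_mul_const, sub_zero] at hs
  have heq : (∫ z, ψ z) * fderiv ℝ u x v =
      -(t⁻¹ * ∫ z, fderiv ℝ ψ z v * u (x + t • z)) +
        t * ∫ z, fderiv ℝ G z v * lap u (x + s • z) := by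
    rw [hibp]
    field_simp
    linarith
  rw [heq]
  calc _ ≤ |-(t⁻¹ * ∫ z, fderiv ℝ ψ z v * u (x + t • z))| +
        |t * ∫ z, fderiv ℝ G z v * lap u (x + s • z)| := abs_add_le _ _
    _ = t⁻¹ * |∫ z, fderiv ℝ ψ z v * u (x + t • z)| +
        t * |∫ z, fderiv ℝ G z v * lap u (x + s • z)| := by
      rw [abs_neg, abs_mul, abs_mul, abs_of_pos ht, abs_of_pos (inv_pos.2 ht)]
    _ ≤ t⁻¹ * ((∫ z, ‖fderiv ℝ ψ z‖) * ‖v‖ * M) + t * ((∫ z, ‖fderiv ℝ G z‖) * ‖v‖ * M) := by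
      gcongr
    _ = _ := by ring

end LocalEstimates


section LocalSolutions

variable {N : ℕ}

theorem exists_contDiff_cutoff {K Ω : Set (EuclideanSpace ℝ (Fin N))} (hK : IsCompact K)
    (hΩ : IsOpen Ω) (hKΩ : K ⊆ Ω) :
    ∃ η : EuclideanSpace ℝ (Fin N) → ℝ, ContDiff ℝ 2 η ∧ HasCompactSupport η ∧ tsupport η ⊆ Ω ∧
      (∀ x, 0 ≤ η x) ∧ (∀ x, η x ≤ 1) ∧ ∀ x ∈ K, ∀ᶠ y in nhds x, η y = 1 := by
  obtain ⟨L, hL, hKL, hLΩ⟩ := exists_compact_between hK hΩ hKΩ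
  obtain ⟨f, hf1, hf0, hf⟩ := exists_contMDiffMap_one_nhds_of_subset_interior
    (modelWithCornersSelf ℝ (EuclideanSpace ℝ (Fin N))) hK.isClosed hKL (n := 2)
  have hsupp : tsupport f ⊆ L :=
    closure_minimal (fun x hx => by_contra fun h => hx (hf0 x h)) hL.isClosed
  refine ⟨f, f.contMDiff.contDiff, hL.of_isClosed_subset (isClosed_tsupport _) hsupp,
    hsupp.trans hLΩ, fun x => (hf x).1, fun x => (hf x).2, fun x hx => ?_⟩
  exact eventually_nhdsSet_iff_forall.1 hf1 x hx

theorem contDiff_mul_of_tsupport_subset {Ω : Set (EuclideanSpace ℝ (Fin N))}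
    (hΩ : IsOpen Ω) {η u : EuclideanSpace ℝ (Fin N) → ℝ} (hη : ContDiff ℝ 2 η)
    (hηΩ : tsupport η ⊆ Ω) (hu : ContDiffOn ℝ 2 u Ω) : ContDiff ℝ 2 (fun y => η y * u y) := by
  rw [contDiff_iff_contDiffAt]
  intro x
  by_cases hx : x ∈ tsupport η
  · exact hη.contDiffAt.mul (hu.contDiffAt (hΩ.mem_nhds (hηΩ hx)))
  · have : (fun y => η y * u y) =ᶠ[nhds x] fun _ => 0 := by
      filter_upwards [(isClosed_tsupport η).isOpen_compl.mem_nhds hx] with y hy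
      rw [image_eq_zero_of_notMem_tsupport hy, zero_mul]
    exact contDiffAt_const.congr_of_eventuallyEq this

theorem exists_contDiff_eventuallyEq {K Ω : Set (EuclideanSpace ℝ (Fin N))} (hK : IsCompact K)
    (hΩ : IsOpen Ω) (hKΩ : K ⊆ Ω) {u : EuclideanSpace ℝ (Fin N) → ℝ} (hu : ContDiffOn ℝ 2 u Ω) :
    ∃ v : EuclideanSpace ℝ (Fin N) → ℝ, ContDiff ℝ 2 v ∧ ∀ x ∈ K, v =ᶠ[nhds x] u := by
  obtain ⟨η, hη, -, hηΩ, -, -, h1⟩ := exists_contDiff_cutoff hK hΩ hKΩ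
  refine ⟨_, contDiff_mul_of_tsupport_subset hΩ hη hηΩ hu, fun x hx => ?_⟩
  filter_upwards [h1 x hx] with y hy
  rw [hy, one_mul]

theorem Filter.EventuallyEq.lap_eq {u v : EuclideanSpace ℝ (Fin N) → ℝ}
    {x : EuclideanSpace ℝ (Fin N)} (h : u =ᶠ[nhds x] v) : lap u x = lap v x := by
  refine Finset.sum_congr rfl fun i _ => ?_
  have : (fun y => fderiv ℝ u y (EuclideanSpace.single i 1)) =ᶠ[nhds x]
      fun y => fderiv ℝ v y (EuclideanSpace.single i 1) := by
    filter_upwards [h.fderiv (𝕜 := ℝ)] with y hy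
    rw [hy]
  rw [this.fderiv_eq]

theorem lap_neg (u : EuclideanSpace ℝ (Fin N) → ℝ) (x : EuclideanSpace ℝ (Fin N)) :
    lap (fun y => -u y) x = -lap u x := by
  simp only [lap, fderiv_fun_neg, neg_apply, Finset.sum_neg_distrib]

theorem lap_comp_add_right (u : EuclideanSpace ℝ (Fin N) → ℝ) (h x : EuclideanSpace ℝ (Fin N)) :
    lap (fun y => u (y + h)) x = lap u (x + h) := by
  simp only [lap, fderiv_comp_add_right]
  refine Finset.sum_congr rfl fun i _ => ?_
  rw [fderiv_comp_add_right (f := fun y => fderiv ℝ u y (EuclideanSpace.single i 1))]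

theorem ContDiffAt.differentiableAt_fderiv_apply {u : EuclideanSpace ℝ (Fin N) → ℝ}
    {x : EuclideanSpace ℝ (Fin N)} (hu : ContDiffAt ℝ 2 u x) (e : EuclideanSpace ℝ (Fin N)) :
    DifferentiableAt ℝ (fun y => fderiv ℝ u y e) x :=
  ((hu.fderiv_right (m := 1) (by norm_num)).differentiableAt (by norm_num)).clm_apply
    (differentiableAt_const e)

theorem ContDiffAt.eventually_differentiableAt {u : EuclideanSpace ℝ (Fin N) → ℝ}
    {x : EuclideanSpace ℝ (Fin N)} (hu : ContDiffAt ℝ 2 u x) :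
    ∀ᶠ y in nhds x, DifferentiableAt ℝ u y :=
  (hu.eventually (by simp)).mono fun _ hy => hy.differentiableAt (by norm_num)

theorem lap_sub {u v : EuclideanSpace ℝ (Fin N) → ℝ} {x : EuclideanSpace ℝ (Fin N)}
    (hu : ContDiffAt ℝ 2 u x) (hv : ContDiffAt ℝ 2 v x) :
    lap (fun y => u y - v y) x = lap u x - lap v x := by
  simp only [lap, ← Finset.sum_sub_distrib]
  refine Finset.sum_congr rfl fun i _ => ?_
  have : (fun y => fderiv ℝ (fun y => u y - v y) y (EuclideanSpace.single i 1)) =ᶠ[nhds x]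
      fun y => fderiv ℝ u y (EuclideanSpace.single i 1) -
        fderiv ℝ v y (EuclideanSpace.single i 1) := by
    filter_upwards [hu.eventually_differentiableAt, hv.eventually_differentiableAt] with y h1 h2
    rw [fderiv_fun_sub h1 h2, sub_apply]
  rw [this.fderiv_eq, fderiv_fun_sub (hu.differentiableAt_fderiv_apply _)
    (hv.differentiableAt_fderiv_apply _), sub_apply]

/-- Local mean value inequality for functions whose Laplacian is bounded below. -/
theorem exists_le_mean_add_of_lap_ge (hN : 2 ≤ N) : ∃ C₀ : ℝ, 0 < C₀ ∧
    ∀ (Ω : Set (EuclideanSpace ℝ (Fin N))) (u : EuclideanSpace ℝ (Fin N) → ℝ)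
      (x : EuclideanSpace ℝ (Fin N)) (t A : ℝ), IsOpen Ω → ContDiffOn ℝ 2 u Ω → 0 < t →
      closedBall x t ⊆ Ω → 0 ≤ A → (∀ y ∈ closedBall x t, -A ≤ lap u y) →
      u x ≤ C₀ * ((t ^ N)⁻¹ * ∫ y in closedBall x t, max (u y) 0) + C₀ * (A * t ^ 2) := by
  obtain ⟨G, ψ, hG, hψ, hG0, hψ0, hG1, hψ1, hGc, hψc, hGψ, hpos⟩ := exists_radial_kernel N hN
  obtain ⟨S, hS⟩ := hψ.continuous.bounded_above_of_compact_support hψc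
  set c := ∫ z, ψ z
  have hS0 : 0 ≤ S := (norm_nonneg _).trans (hS 0)
  have hGi : 0 ≤ ∫ z, G z := integral_nonneg hG0
  refine ⟨(S + (∫ z, G z) + 1) / c, by positivity, fun Ω u x t A hΩ hu ht hb hA hl => ?_⟩
  obtain ⟨v, hv, hvu⟩ := exists_contDiff_eventuallyEq (isCompact_closedBall x t) hΩ hb hu
  have h1 := integral_radial_mul_le_of_lap_ge hG hGc hG0 hG1 hψ hψc hGψ hv ht hA
    (fun y hy => by rw [(hvu y hy).lap_eq]; exact hl y hy)
  have h2 := integral_radial_mul_comp_le hψ.continuous hψc hψ0 hψ1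
    (fun z => (le_abs_self _).trans (hS z)) hv.continuous ht
    (h := fun y => max (u y) 0)
    (((hu.continuousOn.mono hb).sup continuousOn_const).integrableOn_compact
      (isCompact_closedBall x t))
    (fun y hy => by rw [(hvu y hy).eq_of_nhds]; exact le_max_left _ _)
    (fun y _ => le_max_right _ _)
  rw [(hvu x (mem_closedBall_self ht.le)).eq_of_nhds] at h1
  set J := (t ^ N)⁻¹ * ∫ y in closedBall x t, max (u y) 0 with hJ
  have hJ0 : 0 ≤ J := mul_nonneg (by positivity) (integral_nonneg fun y => le_max_right _ _)
  rw [← mul_add, div_mul_eq_mul_div, le_div_iff₀ hpos]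
  have : 0 ≤ A * t ^ 2 := by positivity
  nlinarith

/-- Interior gradient estimate for the Poisson equation. -/
theorem exists_norm_fderiv_le_of_lap (hN : 2 ≤ N) {t : ℝ} (ht : 0 < t) : ∃ C₁ : ℝ, 0 ≤ C₁ ∧
    ∀ (Ω : Set (EuclideanSpace ℝ (Fin N))) (u : EuclideanSpace ℝ (Fin N) → ℝ)
      (x : EuclideanSpace ℝ (Fin N)) (M : ℝ), IsOpen Ω → ContDiffOn ℝ 2 u Ω →
      closedBall x t ⊆ Ω → (∀ y ∈ closedBall x t, |u y| ≤ M) →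
      (∀ y ∈ closedBall x t, |lap u y| ≤ M) → ‖fderiv ℝ u x‖ ≤ C₁ * M := by
  obtain ⟨G, ψ, hG, hψ, hG0, hψ0, hG1, hψ1, hGc, hψc, hGψ, hpos⟩ := exists_radial_kernel N hN
  set c := ∫ z, ψ z
  set D := (t⁻¹ * ∫ z, ‖fderiv ℝ ψ z‖) + t * ∫ z, ‖fderiv ℝ G z‖ with hD
  have hD0 : 0 ≤ D := by positivity
  refine ⟨D / c, by positivity, fun Ω u x M hΩ hu hb hM hl => ?_⟩
  obtain ⟨v, hv, hvu⟩ := exists_contDiff_eventuallyEq (isCompact_closedBall x t) hΩ hb hu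
  have hM0 : 0 ≤ M := (abs_nonneg _).trans (hM x (mem_closedBall_self ht.le))
  refine ContinuousLinearMap.opNorm_le_bound _ (by positivity) fun e => ?_
  have h1 := norm_fderiv_apply_le_of_radial hG hGc hG1 hψ hψc hψ1 hGψ hv (v := e) ht
    (fun y hy => by rw [(hvu y hy).eq_of_nhds]; exact hM y hy)
    (fun y hy => by rw [(hvu y hy).lap_eq]; exact hl y hy)
  rw [(hvu x (mem_closedBall_self ht.le)).fderiv_eq, abs_mul, abs_of_pos hpos] at h1
  rw [div_mul_eq_mul_div, div_mul_eq_mul_div, le_div_iff₀ hpos, Real.norm_eq_abs]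
  linarith

/-- Interior Hessian estimate for the Poisson equation with differentiable right-hand side. -/
theorem exists_norm_fderiv_fderiv_le_of_lap (hN : 2 ≤ N) {t : ℝ} (ht : 0 < t) :
    ∃ C₁ : ℝ, 0 ≤ C₁ ∧
    ∀ (Ω : Set (EuclideanSpace ℝ (Fin N))) (u f : EuclideanSpace ℝ (Fin N) → ℝ)
      (x : EuclideanSpace ℝ (Fin N)) (M : ℝ), IsOpen Ω → ContDiffOn ℝ 2 u Ω →
      closedBall x (2 * t) ⊆ Ω → (∀ y ∈ Ω, lap u y = f y) → (∀ y ∈ Ω, DifferentiableAt ℝ f y) →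
      (∀ y ∈ closedBall x (2 * t), ‖fderiv ℝ u y‖ ≤ M) →
      (∀ y ∈ closedBall x (2 * t), ‖fderiv ℝ f y‖ ≤ M) →
      ‖fderiv ℝ (fderiv ℝ u) x‖ ≤ C₁ * M := by
  obtain ⟨C₁, hC₁, hgrad⟩ := exists_norm_fderiv_le_of_lap hN ht
  refine ⟨C₁, hC₁, fun Ω u f x M hΩ hu hb hl hf hMu hMf => ?_⟩
  have hM0 : 0 ≤ M := (norm_nonneg _).trans (hMu x (mem_closedBall_self (by positivity)))
  refine norm_fderiv_le_of_lip' ℝ (by positivity) ?_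
  filter_upwards [closedBall_mem_nhds x ht] with x' hx'
  set h := x' - x with hh
  have hhn : ‖h‖ ≤ t := by rwa [hh, ← dist_eq_norm]
  have hmem : ∀ y ∈ closedBall x t, y ∈ closedBall x (2 * t) ∧ y + h ∈ closedBall x (2 * t) := by
    intro y hy
    rw [mem_closedBall, dist_eq_norm] at hy
    constructor
    · rw [mem_closedBall, dist_eq_norm]; linarith
    · rw [mem_closedBall, dist_eq_norm, show y + h - x = (y - x) + h by abel]
      linarith [norm_add_le (y - x) h]
  have hcont : ∀ y ∈ Ω, ContDiffAt ℝ 2 u y := fun y hy => hu.contDiffAt (hΩ.mem_nhds hy)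
  have hcont' : ∀ y, y + h ∈ Ω → ContDiffAt ℝ 2 (fun y => u (y + h)) y := fun y hy =>
    (hcont _ hy).comp y (by fun_prop)
  have hlip : ∀ g : EuclideanSpace ℝ (Fin N) → ℝ, (∀ y ∈ Ω, DifferentiableAt ℝ g y) →
      (∀ y ∈ closedBall x (2 * t), ‖fderiv ℝ g y‖ ≤ M) →
      ∀ y ∈ closedBall x t, |g (y + h) - g y| ≤ M * ‖h‖ := by
    intro g hg hgM y hy
    have := (convex_closedBall x (2 * t)).norm_image_sub_le_of_norm_fderiv_le
      (fun z hz => hg z (hb hz)) hgM (hmem y hy).1 (hmem y hy).2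
    simpa using this
  have key := hgrad (Ω ∩ (fun y => y + h) ⁻¹' Ω) (fun y => u (y + h) - u y) x (M * ‖h‖)
    (hΩ.inter (hΩ.preimage (by fun_prop)))
    (fun y hy => ((hcont' y hy.2).sub (hcont y hy.1)).contDiffWithinAt)
    (fun y hy => ⟨hb (hmem y hy).1, hb (hmem y hy).2⟩)
    (hlip u (fun y hy => (hcont y hy).differentiableAt (by norm_num)) hMu)
    (fun y hy => by
      rw [lap_sub (hcont' y (hb (hmem y hy).2)) (hcont y (hb (hmem y hy).1)),
        lap_comp_add_right, hl _ (hb (hmem y hy).1), hl _ (hb (hmem y hy).2)]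
      exact hlip f hf hMf y hy)
  have hxm := hmem x (mem_closedBall_self ht.le)
  rw [fderiv_fun_sub ((hcont' x (hb hxm.2)).differentiableAt (by norm_num))
    ((hcont x (hb hxm.1)).differentiableAt (by norm_num)), fderiv_comp_add_right,
    show x + h = x' by rw [hh]; abel] at key
  linarith

end LocalSolutions


section LocalIntegralBound

variable {N : ℕ}

theorem mul_pow_mul_le_half_rpow_mul_pow_add {p C a e : ℝ} {k : ℕ} (hp : 1 < p) (hC : 0 ≤ C)
    (ha : 0 ≤ a) (he : 0 ≤ e) (he1 : e ≤ 1) (hk : 1 / (p - 1) ≤ k) :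
    C * e ^ (k + 1) * a ≤ 1 / 2 * (e ^ (k + 2) * a ^ p) + C * (2 * C) ^ (1 / (p - 1)) := by
  have hp1 : 0 < p - 1 := by linarith
  have hap : a ^ p = a ^ (p - 1) * a := by
    rcases ha.eq_or_lt with rfl | ha
    · rw [zero_rpow (by linarith), mul_zero]
    · rw [← rpow_add_one ha.ne']; ring_nf
  rcases le_total (2 * C) (a ^ (p - 1) * e) with h | h
  · have h1 : 2 * C * (e ^ (k + 1) * a) ≤ a ^ (p - 1) * e * (e ^ (k + 1) * a) :=
      mul_le_mul_of_nonneg_right h (by positivity)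
    have h2 : 0 ≤ C * (2 * C) ^ (1 / (p - 1)) := by positivity
    have h3 : a ^ (p - 1) * e * (e ^ (k + 1) * a) = e ^ (k + 2) * a ^ p := by rw [hap]; ring
    linarith
  · have h1 : (a ^ (p - 1) * e) ^ (1 / (p - 1)) ≤ (2 * C) ^ (1 / (p - 1)) :=
      rpow_le_rpow (by positivity) h (by positivity)
    rw [mul_rpow (by positivity) he, ← rpow_mul ha, mul_one_div_cancel hp1.ne', rpow_one] at h1
    have h2 : e ^ (k + 1) ≤ e ^ (1 / (p - 1)) := by
      rcases he.eq_or_lt with rfl | he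
      · rw [zero_pow (by omega)]; positivity
      · rw [← rpow_natCast]
        refine rpow_le_rpow_of_exponent_ge he he1 ?_
        push_cast; linarith
    have h3 : C * e ^ (k + 1) * a ≤ C * (2 * C) ^ (1 / (p - 1)) := by
      rw [mul_assoc]
      refine mul_le_mul_of_nonneg_left (le_trans ?_ h1) hC
      rw [mul_comm]
      exact mul_le_mul_of_nonneg_left h2 ha
    have h4 : 0 ≤ 1 / 2 * (e ^ (k + 2) * a ^ p) := by positivity
    linarith

theorem mul_lap_le_lap_pow {η : EuclideanSpace ℝ (Fin N) → ℝ} (hη : ContDiff ℝ 2 η)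
    (h0 : ∀ x, 0 ≤ η x) (k : ℕ) (x : EuclideanSpace ℝ (Fin N)) :
    (k + 2) * η x ^ (k + 1) * lap η x ≤ lap (fun y => η y ^ (k + 2)) x := by
  have hd : ∀ y, HasFDerivAt η (fderiv ℝ η y) y := fun y =>
    (hη.differentiable (by norm_num) y).hasFDerivAt
  simp only [lap, Finset.mul_sum]
  refine Finset.sum_le_sum fun i _ => ?_
  set e : EuclideanSpace ℝ (Fin N) := EuclideanSpace.single i 1
  have h1 : (fun y => fderiv ℝ (fun y => η y ^ (k + 2)) y e) =
      fun y => ((k + 2 : ℝ) * η y ^ (k + 1)) * fderiv ℝ η y e := by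
    ext y
    rw [((hd y).pow (k + 2)).fderiv]
    simp
  have h2 : HasFDerivAt (fun y => (k + 2 : ℝ) * η y ^ (k + 1))
      ((k + 2 : ℝ) • (((k + 1 : ℕ) * η x ^ k : ℝ) • fderiv ℝ η x)) x := by
    simpa using ((hd x).pow (k + 1)).const_mul (k + 2 : ℝ)
  have h3 : HasFDerivAt (fun y => fderiv ℝ η y e) (fderiv ℝ (fun y => fderiv ℝ η y e) x) x :=
    ((hη.fderiv_apply_one e).differentiable (by norm_num) x).hasFDerivAt
  rw [h1, (h2.fun_mul h3).fderiv]
  simp only [add_apply, smul_apply, smul_eq_mul]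
  have := h0 x
  have h4 : 0 ≤ fderiv ℝ η x e * ((k + 2) * ((k + 1 : ℕ) * η x ^ k * fderiv ℝ η x e)) := by
    have : 0 ≤ (k + 2) * ((k + 1 : ℕ) * η x ^ k) * (fderiv ℝ η x e * fderiv ℝ η x e) :=
      mul_nonneg (by positivity) (mul_self_nonneg _)
    linarith
  linarith

theorem integral_lap_mul_eq_integral_mul_lap {φ v : EuclideanSpace ℝ (Fin N) → ℝ}
    (hφ : ContDiff ℝ 2 φ) (hφc : HasCompactSupport φ) (hv : ContDiff ℝ 2 v) :
    ∫ z, lap φ z * v z = ∫ z, φ z * lap v z := by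
  have h1 := sum_integral_fderiv_mul_fderiv (hφ.of_le (by norm_num)) hφc hv 0 1
  have h2 := fun i : Fin N => integral_fderiv_mul_comp_add_smul
    (hφ.fderiv_apply_one (EuclideanSpace.single i 1)) (hφc.fderiv_apply (𝕜 := ℝ) _)
    (hv.of_le (by norm_num)) 0 (EuclideanSpace.single i 1) 1
  simp only [zero_add, one_smul, one_mul] at h1 h2
  rw [← neg_eq_iff_eq_neg.2 h1, ← Finset.sum_neg_distrib]
  simp_rw [← h2]
  rw [← integral_finsetSum]
  · simp_rw [← Finset.sum_mul]; rfl
  · intro i _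
    refine Continuous.integrable_of_hasCompactSupport (Continuous.mul ?_ hv.continuous)
      ((hφc.fderiv_apply (𝕜 := ℝ) _).fderiv_apply (𝕜 := ℝ) _).mul_right
    exact ((hφ.fderiv_apply_one _).continuous_fderiv (by norm_num)).clm_apply continuous_const

/-- Local `L¹` bound for the nonlinearity in terms of a lower bound for the solution. -/
theorem exists_setIntegral_rpow_le {Ω K : Set (EuclideanSpace ℝ (Fin N))} (hΩ : IsOpen Ω)
    (hK : IsCompact K) (hKΩ : K ⊆ Ω) {p : ℝ} (hp : 1 < p) :
    ∃ K', IsCompact K' ∧ K' ⊆ Ω ∧ ∀ M₀ : ℝ, 0 ≤ M₀ → ∃ L : ℝ,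
      ∀ w : EuclideanSpace ℝ (Fin N) → ℝ, ContDiffOn ℝ 2 w Ω →
        (∀ x ∈ Ω, -lap w x = max (w x - 1) 0 ^ p) → (∀ x ∈ K', -M₀ ≤ w x) →
        ∫ x in K, max (w x - 1) 0 ^ p ≤ L := by
  obtain ⟨η, hη, hηc, hηΩ, hη0, hη1, hηK⟩ := exists_contDiff_cutoff hK hΩ hKΩ
  refine ⟨tsupport η, hηc, hηΩ, fun M₀ hM₀ => ?_⟩
  obtain ⟨B, hB⟩ := hηc.exists_bound_of_continuousOn hη.continuous_lap.continuousOn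
  obtain ⟨k, hk⟩ := exists_nat_ge (1 / (p - 1))
  set C := (k + 2) * |B| with hC
  have hC0 : 0 ≤ C := by positivity
  set C' := C * (2 * C) ^ (1 / (p - 1)) + C * (1 + M₀) with hC'
  refine ⟨2 * ∫ x, (tsupport η).indicator (fun _ => C') x, fun w hw hpde hlow => ?_⟩
  obtain ⟨v₀, hv₀, hvw⟩ := exists_contDiff_eventuallyEq hηc hΩ hηΩ hw
  set v : EuclideanSpace ℝ (Fin N) → ℝ := fun y => v₀ y - (-M₀) with hv
  have hvc : ContDiff ℝ 2 v := hv₀.sub contDiff_const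
  have hlap : ∀ x ∈ tsupport η, -lap v x = max (w x - 1) 0 ^ p := by
    intro x hx
    rw [← hpde x (hηΩ hx), hv, lap_sub hv₀.contDiffAt contDiffAt_const, (hvw x hx).lap_eq]
    simp [lap]
  have hvx : ∀ x ∈ tsupport η, v x = w x + M₀ := by
    intro x hx
    simp only [hv, (hvw x hx).eq_of_nhds]; ring
  set φ : EuclideanSpace ℝ (Fin N) → ℝ := fun y => η y ^ (k + 2) with hφ
  have hφc : ContDiff ℝ 2 φ := hη.pow _
  have hφs : HasCompactSupport φ := hηc.comp_left (g := fun s => s ^ (k + 2)) (by simp)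
  have hφ0 : ∀ x, 0 ≤ φ x := fun x => pow_nonneg (hη0 x) _
  have hout : ∀ x, x ∉ tsupport η → φ x = 0 ∧ lap φ x = 0 := by
    intro x hx
    have : φ =ᶠ[nhds x] fun _ => 0 := by
      filter_upwards [(isClosed_tsupport η).isOpen_compl.mem_nhds hx] with y hy
      simp [hφ, image_eq_zero_of_notMem_tsupport hy]
    exact ⟨this.eq_of_nhds, by rw [this.lap_eq]; simp [lap]⟩
  have hInt : Integrable fun z => φ z * -lap v z :=
    (hφc.continuous.mul hvc.continuous_lap.neg).integrable_of_hasCompactSupport hφs.mul_right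
  have hlapφ : HasCompactSupport (lap φ) :=
    HasCompactSupport.intro hηc fun x hx => (hout x hx).2
  have hpt : ∀ z, -(lap φ z * v z) ≤
      1 / 2 * (φ z * -lap v z) + (tsupport η).indicator (fun _ => C') z := by
    intro z
    by_cases hz : z ∈ tsupport η
    · rw [indicator_of_mem hz, hlap z hz]
      have h1 := mul_lap_le_lap_pow hη hη0 k z
      have h2 : -|B| ≤ lap η z := by
        have := (hB z hz).trans (le_abs_self B)
        rw [Real.norm_eq_abs] at this
        exact (abs_le.1 this).1
      have h3 : -(C * η z ^ (k + 1)) ≤ lap φ z := by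
        refine le_trans ?_ h1
        have := mul_le_mul_of_nonneg_left h2
          (mul_nonneg (by positivity : (0 : ℝ) ≤ k + 2) (pow_nonneg (hη0 z) (k + 1)))
        rw [hC]; linarith
      have hvz : 0 ≤ v z := by rw [hvx z hz]; linarith [hlow z hz]
      have h4 : -(lap φ z * v z) ≤ C * η z ^ (k + 1) * v z := by
        have := mul_le_mul_of_nonneg_right h3 hvz
        linarith
      have h5 : v z ≤ max (w z - 1) 0 + (1 + M₀) := by
        rw [hvx z hz]; linarith [le_max_left (w z - 1) 0]
      have h6 := mul_pow_mul_le_half_rpow_mul_pow_add hp hC0 (le_max_right (w z - 1) 0)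
        (hη0 z) (hη1 z) hk
      have h7 : C * η z ^ (k + 1) * (1 + M₀) ≤ C * (1 + M₀) := by
        refine mul_le_mul_of_nonneg_right ?_ (by linarith)
        exact mul_le_of_le_one_right hC0 (pow_le_one₀ (hη0 z) (hη1 z))
      have h8 : C * η z ^ (k + 1) * v z ≤
          C * η z ^ (k + 1) * (max (w z - 1) 0 + (1 + M₀)) :=
        mul_le_mul_of_nonneg_left h5 (mul_nonneg hC0 (pow_nonneg (hη0 z) _))
      rw [hC']
      linarith
    · rw [indicator_of_notMem hz, (hout z hz).1, (hout z hz).2]; simp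
  have hind : Integrable ((tsupport η).indicator fun _ => C') :=
    (integrable_indicator_iff hηc.isClosed.measurableSet).2
      (integrableOn_const hηc.measure_lt_top.ne)
  have hlapc : Continuous (lap φ) := hφc.continuous_lap
  have hmain : ∫ z, φ z * -lap v z ≤
      1 / 2 * (∫ z, φ z * -lap v z) + ∫ z, (tsupport η).indicator (fun _ => C') z := by
    rw [← integral_const_mul, ← integral_add (hInt.const_mul _) hind]
    have heq : ∫ z, φ z * -lap v z = ∫ z, -(lap φ z * v z) := by
      simp_rw [mul_neg, integral_neg]
      rw [integral_lap_mul_eq_integral_mul_lap hφc hφs hvc]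
    rw [heq]
    exact integral_mono ((hlapc.mul hvc.continuous).integrable_of_hasCompactSupport
      hlapφ.mul_right).neg ((hInt.const_mul _).add hind) hpt
  have hnn : ∀ z, 0 ≤ φ z * -lap v z := by
    intro z
    by_cases hz : z ∈ tsupport η
    · rw [hlap z hz]
      exact mul_nonneg (hφ0 z) (rpow_nonneg (le_max_right _ _) _)
    · rw [(hout z hz).1, zero_mul]
  have hKeq : ∫ x in K, max (w x - 1) 0 ^ p = ∫ x in K, φ x * -lap v x := by
    refine setIntegral_congr_fun hK.measurableSet fun x hx => ?_
    have h1 : η x = 1 := (hηK x hx).self_of_nhds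
    have hm : x ∈ tsupport η := subset_tsupport _ (by simp [h1])
    simp only [hφ, h1, hlap x hm]; simp
  rw [hKeq]
  have := setIntegral_le_integral (s := K) hInt (Eventually.of_forall hnn)
  linarith

end LocalIntegralBound


section LocalSupBound

variable {N : ℕ}

theorem le_add_rpow_mul_rpow {p v l : ℝ} (hp : 1 < p) (hv : 0 ≤ v) (hl : 0 < l) :
    v ≤ l + l ^ (1 - p) * v ^ p := by
  rcases le_total v l with h | h
  · have : 0 ≤ l ^ (1 - p) * v ^ p := by positivity
    linarith
  · have hv0 : 0 < v := hl.trans_le h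
    have h1 : v ^ (1 - p) ≤ l ^ (1 - p) := rpow_le_rpow_of_nonpos hl h (by linarith)
    have h2 : v = v ^ (1 - p) * v ^ p := by rw [← rpow_add hv0]; simp
    have h3 : v ^ (1 - p) * v ^ p ≤ l ^ (1 - p) * v ^ p :=
      mul_le_mul_of_nonneg_right h1 (by positivity)
    linarith

theorem le_rpow_of_le_mul_rpow {p A q κ b D : ℝ} (hA : 0 < A) (hq : 0 < q)
    (hθ : 0 < p - N * b)
    (h : A ≤ D * (A / q) ^ (1 - p) * ((κ * A ^ (-b)) ^ N)⁻¹) :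
    A ≤ (D * (q ^ (1 - p))⁻¹ * (κ ^ N)⁻¹) ^ (1 / (p - N * b)) := by
  have h1 : (κ * A ^ (-b)) ^ N = κ ^ N * (A ^ (N * b))⁻¹ := by
    rw [mul_pow, ← rpow_mul_natCast hA.le, ← rpow_neg hA.le]; ring_nf
  rw [h1, div_rpow hA.le hq.le, mul_inv, inv_inv] at h
  have h2 : A ^ (p - N * b) ≤ D * (q ^ (1 - p))⁻¹ * (κ ^ N)⁻¹ := by
    have h3 : A ^ (p - N * b) = A * A ^ (p - N * b - 1) := by
      rw [rpow_sub_one hA.ne']; field_simp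
    have h4 : A ^ (1 - p) * A ^ (N * b) * A ^ (p - N * b - 1) = 1 := by
      rw [← rpow_add hA, ← rpow_add hA]; ring_nf; simp
    calc A ^ (p - N * b) = A * A ^ (p - N * b - 1) := h3
      _ ≤ D * (A ^ (1 - p) / q ^ (1 - p)) * ((κ ^ N)⁻¹ * A ^ (N * b)) * A ^ (p - N * b - 1) :=
        mul_le_mul_of_nonneg_right h (by positivity)
      _ = D * (q ^ (1 - p))⁻¹ * (κ ^ N)⁻¹ *
          (A ^ (1 - p) * A ^ (N * b) * A ^ (p - N * b - 1)) := by ring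
      _ = _ := by rw [h4, mul_one]
  calc A = (A ^ (p - N * b)) ^ (1 / (p - N * b)) := by
        rw [← rpow_mul hA.le, mul_one_div_cancel hθ.ne', rpow_one]
    _ ≤ _ := rpow_le_rpow (by positivity) h2 (by positivity)

/-- Local `L∞` bound from above in the subcritical range, from a local `L¹` bound of the
nonlinearity. -/
theorem exists_le_of_setIntegral_rpow_le (hN : 2 ≤ N) {p : ℝ} (hp : 1 < p)
    (hpN : 2 < N → p < (N : ℝ) / ((N : ℝ) - 2)) {R L : ℝ} (hR : 0 < R) (hL : 0 ≤ L) :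
    ∃ M : ℝ, ∀ (Ω : Set (EuclideanSpace ℝ (Fin N))) (w : EuclideanSpace ℝ (Fin N) → ℝ)
      (x₀ : EuclideanSpace ℝ (Fin N)), IsOpen Ω → ContDiffOn ℝ 2 w Ω →
      (∀ x ∈ Ω, -lap w x = max (w x - 1) 0 ^ p) → closedBall x₀ R ⊆ Ω →
      (∫ x in closedBall x₀ R, max (w x - 1) 0 ^ p) ≤ L →
      ∀ x ∈ closedBall x₀ (R / 2), w x ≤ M := by
  obtain ⟨C₀, hC₀, hmean⟩ := exists_le_mean_add_of_lap_ge hN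
  have hp1 : 0 < p - 1 := by linarith
  set V := (volume : Measure (EuclideanSpace ℝ (Fin N))).real (ball 0 1) with hV
  have hVpos : 0 < V := 
    ENNReal.toReal_pos (measure_ball_pos _ _ one_pos).ne' measure_ball_lt_top.ne
  set b := (p - 1) / 2 with hb
  have hb0 : 0 < b := by positivity
  set a := 1 / b with ha
  have ha0 : 0 < a := by positivity
  have hab : b * a = 1 := by rw [ha]; field_simp
  have hθ : 0 < p - N * b := by
    rcases hN.eq_or_lt with h | h
    · rw [← h, hb]; push_cast; linarith
    · have h2 : (2 : ℝ) < N := by exact_mod_cast h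
      have h3 := hpN h
      rw [lt_div_iff₀ (by linarith)] at h3
      rw [hb]; linarith
  set Q := ((2 : ℝ) ^ a) ^ p with hQ
  have hQ0 : 0 < Q := by positivity
  set κ := √(1 / (4 * C₀ * Q)) with hκ
  have hκ0 : 0 < κ := by positivity
  have hκ2 : C₀ * Q * κ ^ 2 = 1 / 4 := by
    rw [hκ, sq_sqrt (by positivity)]; field_simp
  set q := 4 * C₀ * V with hq
  have hq0 : 0 < q := by positivity
  set Amax := ((2 * C₀ * L) * (q ^ (1 - p))⁻¹ * (κ ^ N)⁻¹) ^ (1 / (p - N * b)) with hAmax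
  have hAmax0 : 0 ≤ Amax := by positivity
  set m := (2 * κ) ^ a + R ^ a * Amax with hm
  have hm0 : 0 ≤ m := by positivity
  refine ⟨1 + m / (R / 2) ^ a, fun Ω w x₀ hΩ hw hpde hball hInt => ?_⟩
  set v : EuclideanSpace ℝ (Fin N) → ℝ := fun x => max (w x - 1) 0 with hv
  have hv0 : ∀ x, 0 ≤ v x := fun x => le_max_right _ _
  have hwc : ContinuousOn w (closedBall x₀ R) := hw.continuousOn.mono hball
  have hvc : ContinuousOn v (closedBall x₀ R) := (hwc.sub continuousOn_const).sup
    continuousOn_const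
  set g : EuclideanSpace ℝ (Fin N) → ℝ := fun x => (R - dist x x₀) ^ a * v x with hg
  have hgc : ContinuousOn g (closedBall x₀ R) := by
    refine ContinuousOn.mul (ContinuousOn.rpow_const (by fun_prop) fun x _ => Or.inr ha0.le) hvc
  obtain ⟨y, hy, hmax⟩ := (isCompact_closedBall x₀ R).exists_isMaxOn
    (nonempty_closedBall.2 hR.le) hgc
  suffices hgy : g y ≤ m by
    intro x hx
    have hxR : x ∈ closedBall x₀ R := closedBall_subset_closedBall (by linarith) hx
    have h1 : g x ≤ m := (hmax hxR).trans hgy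
    have h2 : (R / 2) ^ a ≤ (R - dist x x₀) ^ a :=
      rpow_le_rpow (by positivity) (by rw [mem_closedBall] at hx; linarith) ha0.le
    have h3 : v x ≤ m / (R / 2) ^ a := by
      rw [le_div_iff₀ (by positivity), mul_comm]
      exact (mul_le_mul_of_nonneg_right h2 (hv0 x)).trans h1
    linarith [le_max_left (w x - 1) 0]
  set d := R - dist y x₀ with hd
  have hd0 : 0 ≤ d := by rw [mem_closedBall] at hy; linarith
  set A := v y with hAdef
  have hgyd : g y = d ^ a * A := rfl
  rcases hd0.eq_or_lt with hd0 | hd0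
  · rw [hgyd, ← hd0, zero_rpow ha0.ne', zero_mul]; exact hm0
  rcases (hv0 y).eq_or_lt with hA0 | hA0
  · rw [hgyd, hAdef, ← hA0, mul_zero]; exact hm0
  replace hA0 : 0 < A := hA0
  set δ := κ * A ^ (-b) with hδ
  have hδ0 : 0 < δ := by positivity
  rcases lt_or_ge (d / 2) δ with hcase | hcase
  · have h1 : d ^ a ≤ (2 * δ) ^ a := rpow_le_rpow hd0.le (by linarith) ha0.le
    have h2 : (2 * δ) ^ a * A = (2 * κ) ^ a := by
      rw [hδ, ← mul_assoc, mul_rpow (by positivity) (by positivity), ← rpow_mul hA0.le,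
        neg_mul, hab, rpow_neg_one]
      field_simp
    have h3 := mul_le_mul_of_nonneg_right h1 hA0.le
    have h4 : 0 ≤ R ^ a * Amax := by positivity
    rw [hgyd, hm]
    linarith
  · have hsub : closedBall y δ ⊆ closedBall x₀ R := by
      refine closedBall_subset_closedBall' ?_
      linarith
    have hvle : ∀ z ∈ closedBall y δ, v z ≤ 2 ^ a * A := by
      intro z hz
      have h1 : g z ≤ d ^ a * A := hmax (hsub hz)
      have h2 : (d / 2) ^ a ≤ (R - dist z x₀) ^ a := by
        refine rpow_le_rpow (by positivity) ?_ ha0.le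
        rw [mem_closedBall] at hz
        linarith [dist_triangle z y x₀]
      have h3 : (d / 2) ^ a * v z ≤ d ^ a * A :=
        (mul_le_mul_of_nonneg_right h2 (hv0 z)).trans h1
      rw [div_rpow hd0.le zero_le_two, div_mul_eq_mul_div, div_le_iff₀ (by positivity)] at h3
      have h4 : d ^ a * v z ≤ d ^ a * (2 ^ a * A) := by linarith
      exact le_of_mul_le_mul_left h4 (by positivity)
    have hfle : ∀ z ∈ closedBall y δ, v z ^ p ≤ Q * A ^ p := by
      intro z hz
      rw [hQ, ← mul_rpow (by positivity) hA0.le]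
      exact rpow_le_rpow (hv0 z) (hvle z hz) (by linarith)
    have hmv := hmean Ω (fun z => w z - 1) y δ (Q * A ^ p) hΩ (hw.sub contDiffOn_const) hδ0
      (hsub.trans hball) (by positivity) (fun z hz => by
        have hzΩ := hball (hsub hz)
        rw [lap_sub (hw.contDiffAt (hΩ.mem_nhds hzΩ)) contDiffAt_const]
        have h1 := hpde z hzΩ
        have h2 := hfle z hz
        have h3 : lap (fun _ : EuclideanSpace ℝ (Fin N) => (1 : ℝ)) z = 0 := by simp [lap]
        rw [h3]
        simp only [hv] at h2
        linarith)
    have hwA : w y - 1 = A := by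
      rw [hAdef, hv]
      refine (max_eq_left ?_).symm
      by_contra! h
      have : v y = 0 := max_eq_right h.le
      linarith
    set l := A / q with hl
    have hl0 : 0 < l := by positivity
    have hfi : IntegrableOn (fun z => v z ^ p) (closedBall x₀ R) :=
      (hvc.rpow_const fun x _ => Or.inr (by linarith)).integrableOn_compact
        (isCompact_closedBall _ _)
    have hvol : (volume : Measure (EuclideanSpace ℝ (Fin N))).real (closedBall y δ) =
        δ ^ N * V := by
      rw [Measure.addHaar_real_closedBall _ _ hδ0.le, finrank_euclideanSpace_fin]
    have hIv : ∫ z in closedBall y δ, v z ≤ l * (δ ^ N * V) + l ^ (1 - p) * L := by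
      have hci : Integrable (fun _ => l) (volume.restrict (closedBall y δ)) :=
        integrableOn_const measure_closedBall_lt_top.ne
      have hfi' : Integrable (fun z => l ^ (1 - p) * v z ^ p)
          (volume.restrict (closedBall y δ)) := (hfi.mono_set hsub).const_mul _
      have h1 : ∫ z in closedBall y δ, v z ≤
          ∫ z in closedBall y δ, (l + l ^ (1 - p) * v z ^ p) := by
        refine integral_mono ((hvc.mono hsub).integrableOn_compact (isCompact_closedBall _ _))
          ?_ fun z => le_add_rpow_mul_rpow hp (hv0 z) hl0
        exact hci.add hfi'
      rw [integral_add hci hfi', integral_const_mul, setIntegral_const, hvol,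
        smul_eq_mul] at h1
      have h2 : ∫ z in closedBall y δ, v z ^ p ≤ L :=
        (setIntegral_mono_set hfi (Eventually.of_forall fun z => rpow_nonneg (hv0 z) _)
          hsub.eventuallyLE).trans hInt
      have h3 := mul_le_mul_of_nonneg_left h2 (by positivity : 0 ≤ l ^ (1 - p))
      linarith
    have hQA : C₀ * (Q * A ^ p * δ ^ 2) = A / 4 := by
      have h1 : A ^ p * (A ^ (-b)) ^ 2 = A := by
        rw [← rpow_mul_natCast hA0.le, ← rpow_add hA0, hb]
        have : p + -((p - 1) / 2) * ((2 : ℕ) : ℝ) = 1 := by push_cast; ring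
        rw [this, rpow_one]
      calc C₀ * (Q * A ^ p * δ ^ 2) = (C₀ * Q * κ ^ 2) * (A ^ p * (A ^ (-b)) ^ 2) := by
            rw [hδ]; ring
        _ = A / 4 := by rw [hκ2, h1]; ring
    have hmid : C₀ * ((δ ^ N)⁻¹ * (l * (δ ^ N * V) + l ^ (1 - p) * L)) =
        A / 4 + C₀ * L * l ^ (1 - p) * (δ ^ N)⁻¹ := by
      have h1 : C₀ * l * V = A / 4 := by rw [hl, hq]; field_simp
      have h2 : δ ^ N ≠ 0 := by positivity
      rw [← h1]; field_simp
    have h5 := mul_le_mul_of_nonneg_left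
      (mul_le_mul_of_nonneg_left hIv (by positivity : 0 ≤ (δ ^ N)⁻¹)) hC₀.le
    rw [hmid] at h5
    rw [hQA, hwA] at hmv
    have hfin : A ≤ 2 * C₀ * L * (A / q) ^ (1 - p) * ((κ * A ^ (-b)) ^ N)⁻¹ := by
      rw [← hl, ← hδ]
      simp only [hv] at h5
      linarith
    have hAle := le_rpow_of_le_mul_rpow hA0 hq0 hθ hfin
    have hdR : d ^ a ≤ R ^ a :=
      rpow_le_rpow hd0.le (by linarith [dist_nonneg (x := y) (y := x₀)]) ha0.le
    have h6 : d ^ a * A ≤ R ^ a * Amax := mul_le_mul hdR hAle hA0.le (by positivity)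
    have h7 : 0 ≤ (2 * κ) ^ a := by positivity
    rw [hgyd, hm]
    linarith

end LocalSupBound


section LocalCompactness

theorem hasDerivAt_max_sub_one_rpow {p : ℝ} (hp : 1 < p) (s : ℝ) :
    HasDerivAt (fun s : ℝ => max (s - 1) 0 ^ p) (p * max (s - 1) 0 ^ (p - 1)) s := by
  refine hasDerivAt_of_hasDerivAt_of_ne' (x := 1)
    (g := fun s : ℝ => p * max (s - 1) 0 ^ (p - 1)) (fun y hy => ?_) ?_ ?_ s
  · rcases hy.lt_or_gt with h | h
    · have h1 : (fun s : ℝ => max (s - 1) 0 ^ p) =ᶠ[nhds y] fun _ => 0 := by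
        filter_upwards [Iio_mem_nhds h] with z hz
        rw [max_eq_right (by linarith [mem_Iio.1 hz]), zero_rpow (by linarith)]
      simp only [max_eq_right (by linarith : y - 1 ≤ 0)]
      rw [zero_rpow (by linarith), mul_zero]
      exact (hasDerivAt_const y (0 : ℝ)).congr_of_eventuallyEq h1
    · have h1 : (fun s : ℝ => max (s - 1) 0 ^ p) =ᶠ[nhds y] fun s => (s - 1) ^ p := by
        filter_upwards [Ioi_mem_nhds h] with z hz
        rw [max_eq_left (by linarith [mem_Ioi.1 hz])]
      simp only [max_eq_left (by linarith : 0 ≤ y - 1)]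
      have h2 := ((hasDerivAt_id y).sub_const 1).rpow_const (p := p) (Or.inr hp.le)
      simp only [id, one_mul] at h2
      exact h2.congr_of_eventuallyEq h1
  · exact Continuous.continuousAt (Continuous.rpow_const (by fun_prop) fun _ =>
      Or.inr (by linarith))
  · exact Continuous.continuousAt (continuous_const.mul (Continuous.rpow_const (by fun_prop)
      fun _ => Or.inr (by linarith)))

theorem contDiff_one_max_sub_one_rpow {p : ℝ} (hp : 1 < p) :
    ContDiff ℝ 1 fun s : ℝ => max (s - 1) 0 ^ p := by
  rw [contDiff_one_iff_deriv]
  refine ⟨fun s => (hasDerivAt_max_sub_one_rpow hp s).differentiableAt, ?_⟩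
  rw [funext fun s => (hasDerivAt_max_sub_one_rpow hp s).deriv]
  exact continuous_const.mul (Continuous.rpow_const (by fun_prop) fun _ =>
    Or.inr (by linarith))

theorem exists_isCompact_closedBall_subset {X : Type*} [PseudoMetricSpace X] [ProperSpace X]
    {Ω K : Set X} (hΩ : IsOpen Ω) (hK : IsCompact K) (hKΩ : K ⊆ Ω) :
    ∃ δ, 0 < δ ∧ ∃ K', IsCompact K' ∧ K' ⊆ Ω ∧ ∀ x ∈ K, closedBall x δ ⊆ K' := by
  obtain ⟨δ, hδ, h⟩ := hK.exists_cthickening_subset_open hΩ hKΩ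
  exact ⟨δ, hδ, cthickening δ K, hK.cthickening, h, fun x hx =>
    closedBall_subset_cthickening hx δ⟩

theorem UniformCauchySeqOn.continuous_comp {X : Type*} {K : Set X} {u : ℕ → X → ℝ} {F : ℝ → ℝ}
    {M : ℝ} (hu : UniformCauchySeqOn u atTop K) (hF : Continuous F)
    (hM : ∀ n, ∀ x ∈ K, |u n x| ≤ M) :
    UniformCauchySeqOn (fun n x => F (u n x)) atTop K := by
  rw [Metric.uniformCauchySeqOn_iff] at hu ⊢
  intro ε hε
  obtain ⟨δ, hδ, h⟩ := Metric.uniformContinuousOn_iff.1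
    ((isCompact_Icc (a := -M) (b := M)).uniformContinuousOn_of_continuous hF.continuousOn) ε hε
  obtain ⟨n₀, hn₀⟩ := hu δ hδ
  exact ⟨n₀, fun m hm n hn x hx => h _ (abs_le.1 (hM m x hx)) _ (abs_le.1 (hM n x hx))
    (hn₀ m hm n hn x hx)⟩

theorem UniformCauchySeqOn.smul_of_bounded {X E : Type*} [NormedAddCommGroup E] [NormedSpace ℝ E]
    {K : Set X} {a : ℕ → X → ℝ} {v : ℕ → X → E} {A B : ℝ} (ha : UniformCauchySeqOn a atTop K)
    (hv : UniformCauchySeqOn v atTop K) (hA : ∀ n, ∀ x ∈ K, |a n x| ≤ A)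
    (hB : ∀ n, ∀ x ∈ K, ‖v n x‖ ≤ B) :
    UniformCauchySeqOn (fun n x => a n x • v n x) atTop K := by
  rcases K.eq_empty_or_nonempty with rfl | ⟨x₀, hx₀⟩
  · rw [Metric.uniformCauchySeqOn_iff]; simp
  have hA0 : 0 ≤ A := (abs_nonneg _).trans (hA 0 x₀ hx₀)
  have hB0 : 0 ≤ B := (norm_nonneg _).trans (hB 0 x₀ hx₀)
  rw [Metric.uniformCauchySeqOn_iff] at ha hv ⊢
  intro ε hε
  set η := ε / (A + B + 1) with hη
  have hη0 : 0 < η := by positivity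
  obtain ⟨n₁, hn₁⟩ := ha η hη0
  obtain ⟨n₂, hn₂⟩ := hv η hη0
  refine ⟨max n₁ n₂, fun m hm n hn x hx => ?_⟩
  have h1 := hn₁ m (le_of_max_le_left hm) n (le_of_max_le_left hn) x hx
  have h2 := hn₂ m (le_of_max_le_right hm) n (le_of_max_le_right hn) x hx
  rw [dist_eq_norm] at h1 h2 ⊢
  have h3 : a m x • v m x - a n x • v n x =
      (a m x - a n x) • v m x + a n x • (v m x - v n x) := by
    rw [sub_smul, smul_sub]; abel
  have h4 : η * (A + B + 1) = ε := by rw [hη]; field_simp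
  calc ‖a m x • v m x - a n x • v n x‖
      ≤ ‖a m x - a n x‖ * ‖v m x‖ + ‖a n x‖ * ‖v m x - v n x‖ := by
        rw [h3, ← norm_smul, ← norm_smul]; exact norm_add_le _ _
    _ ≤ η * B + A * η := by
        gcongr
        · exact hB m x hx
        · exact hA n x hx
    _ < ε := by nlinarith

theorem uniformCauchySeqOn_of_norm_sub_le {X A B D : Type*} [NormedAddCommGroup A]
    [NormedAddCommGroup B] [NormedAddCommGroup D] {K K' : Set X} {u : ℕ → X → A} {f : ℕ → X → B}
    {g : ℕ → X → D} {c : ℝ} (hc : 0 ≤ c) (hu : UniformCauchySeqOn u atTop K')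
    (hf : UniformCauchySeqOn f atTop K')
    (h : ∀ m n M, (∀ y ∈ K', ‖u m y - u n y‖ ≤ M) → (∀ y ∈ K', ‖f m y - f n y‖ ≤ M) →
      ∀ x ∈ K, ‖g m x - g n x‖ ≤ c * M) : UniformCauchySeqOn g atTop K := by
  simp only [Metric.uniformCauchySeqOn_iff, dist_eq_norm] at hu hf ⊢
  intro ε hε
  set η := ε / (c + 1) with hη
  have hη0 : 0 < η := by positivity
  obtain ⟨n₁, hn₁⟩ := hu η hη0
  obtain ⟨n₂, hn₂⟩ := hf η hη0
  refine ⟨max n₁ n₂, fun m hm n hn x hx => (h m n η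
    (fun y hy => (hn₁ m (le_of_max_le_left hm) n (le_of_max_le_left hn) y hy).le)
    (fun y hy => (hn₂ m (le_of_max_le_right hm) n (le_of_max_le_right hn) y hy).le)
    x hx).trans_lt ?_⟩
  have h4 : η * (c + 1) = ε := by rw [hη]; field_simp
  nlinarith

theorem exists_tendstoLocallyUniformlyOn_of_uniformCauchySeqOn {X E : Type*} [TopologicalSpace X]
    [LocallyCompactSpace X] [NormedAddCommGroup E] [CompleteSpace E] {Ω : Set X}
    (hΩ : IsOpen Ω) {u : ℕ → X → E}
    (hu : ∀ K, IsCompact K → K ⊆ Ω → UniformCauchySeqOn u atTop K) :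
    ∃ g, TendstoLocallyUniformlyOn u g atTop Ω := by
  have h : ∀ x, ∃ y, x ∈ Ω → Tendsto (fun n => u n x) atTop (nhds y) := by
    intro x
    by_cases hx : x ∈ Ω
    · obtain ⟨y, hy⟩ := cauchySeq_tendsto_of_complete
        ((hu {x} isCompact_singleton (singleton_subset_iff.2 hx)).cauchySeq (mem_singleton x))
      exact ⟨y, fun _ => hy⟩
    · exact ⟨0, fun h => absurd h hx⟩
  choose g hg using h
  exact ⟨g, (tendstoLocallyUniformlyOn_iff_forall_isCompact hΩ).2 fun K hKΩ hK =>
    (hu K hK hKΩ).tendstoUniformlyOn_of_tendsto fun x hx => hg x (hKΩ hx)⟩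

theorem tendstoLocallyUniformlyOn_iteratedFDeriv_zero {E F : Type*} [NormedAddCommGroup E]
    [NormedSpace ℝ E] [NormedAddCommGroup F] [NormedSpace ℝ F] {Ω : Set E} {u : ℕ → E → F}
    {g : E → F} (h : TendstoLocallyUniformlyOn u g atTop Ω) :
    TendstoLocallyUniformlyOn (fun n => iteratedFDeriv ℝ 0 (u n)) (iteratedFDeriv ℝ 0 g)
      atTop Ω :=
  (continuousMultilinearCurryFin0 ℝ E F).symm.isometry.uniformContinuous
    |>.comp_tendstoLocallyUniformlyOn h

theorem tendstoLocallyUniformlyOn_iteratedFDeriv_succ {E F : Type*} [NormedAddCommGroup E]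
    [NormedSpace ℝ E] [NormedAddCommGroup F] [NormedSpace ℝ F] {Ω : Set E} {u : ℕ → E → F}
    {g : E → F} {k : ℕ}
    (h : TendstoLocallyUniformlyOn (fun n => iteratedFDeriv ℝ k (fderiv ℝ (u n)))
      (iteratedFDeriv ℝ k (fderiv ℝ g)) atTop Ω) :
    TendstoLocallyUniformlyOn (fun n => iteratedFDeriv ℝ (k + 1) (u n))
      (iteratedFDeriv ℝ (k + 1) g) atTop Ω := by
  have key : ∀ f : E → F, iteratedFDeriv ℝ (k + 1) f =
      (continuousMultilinearCurryRightEquiv' ℝ k E F).symm ∘ iteratedFDeriv ℝ k (fderiv ℝ f) :=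
    fun f => funext fun x => iteratedFDeriv_succ_eq_comp_right
  simp only [key]
  exact (continuousMultilinearCurryRightEquiv' ℝ k E F).symm.isometry.uniformContinuous
    |>.comp_tendstoLocallyUniformlyOn h

/-- Arzelà–Ascoli for functions with locally bounded gradients. -/
theorem exists_subseq_uniformCauchySeqOn {E : Type*} [NormedAddCommGroup E] [NormedSpace ℝ E]
    [FiniteDimensional ℝ E] {Ω : Set E} (hΩ : IsOpen Ω) {w : ℕ → E → ℝ}
    (hw : ∀ n, ∀ x ∈ Ω, DifferentiableAt ℝ (w n) x)
    (hbd : ∀ K, IsCompact K → K ⊆ Ω → ∃ M, ∀ n, ∀ x ∈ K, |w n x| ≤ M)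
    (hbd' : ∀ K, IsCompact K → K ⊆ Ω → ∃ M, ∀ n, ∀ x ∈ K, ‖fderiv ℝ (w n) x‖ ≤ M) :
    ∃ φ : ℕ → ℕ, StrictMono φ ∧
      ∀ K, IsCompact K → K ⊆ Ω → UniformCauchySeqOn (fun n => w (φ n)) atTop K := by
  have : ProperSpace E := FiniteDimensional.proper ℝ E
  have : LocallyCompactSpace Ω := hΩ.locallyCompactSpace
  let f : ℕ → C(Ω, ℝ) := fun n => ⟨fun x => w n x, continuous_iff_continuousAt.2 fun x =>
    (hw n x x.2).continuousAt.comp continuous_subtype_val.continuousAt⟩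
  have hcpt : IsCompact (closure (range f)) := by
    refine ArzelaAscoli.isCompact_closure_of_isClosedEmbedding (𝔖 := {K : Set Ω | IsCompact K})
      (F := fun (f : C(Ω, ℝ)) (x : Ω) => f x) (fun K hK => hK)
      ⟨ContinuousMap.isUniformEmbedding_toUniformOnFunIsCompact.isEmbedding, ?_⟩ ?_ ?_
    · change IsClosed (range (ContinuousMap.toUniformOnFunIsCompact))
      rw [ContinuousMap.range_toUniformOnFunIsCompact]
      exact UniformOnFun.isClosed_setOfPred_continuous
        (.of_nhds fun x => exists_compact_mem_nhds x)
    · intro K _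
      refine Equicontinuous.equicontinuousOn (fun x => ?_) K
      rw [Metric.equicontinuousAt_iff]
      intro ε hε
      obtain ⟨r, hr, hrΩ⟩ := Metric.nhds_basis_closedBall.mem_iff.1 (hΩ.mem_nhds x.2)
      obtain ⟨M, hM⟩ := hbd' _ (isCompact_closedBall (x : E) r) hrΩ
      have hM0 : 0 ≤ M := (norm_nonneg _).trans (hM 0 x (mem_closedBall_self hr.le))
      refine ⟨min r (ε / (M + 1)), by positivity, fun y hy => ?_⟩
      rintro ⟨_, n, rfl⟩
      have hy1 : dist (y : E) x < r := lt_of_lt_of_le hy (min_le_left _ _)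
      have hy2 : dist (y : E) x < ε / (M + 1) := lt_of_lt_of_le hy (min_le_right _ _)
      have h1 := (convex_closedBall (x : E) r).norm_image_sub_le_of_norm_fderiv_le
        (fun z hz => hw n z (hrΩ hz)) (fun z hz => hM n z hz)
        (mem_closedBall.2 hy1.le) (mem_closedBall_self hr.le)
      rw [← dist_eq_norm, ← dist_eq_norm, dist_comm (x : E) y] at h1
      rw [lt_div_iff₀ (by positivity)] at hy2
      change dist (w n x) (w n y) < ε
      nlinarith [dist_nonneg (x := (y : E)) (y := x)]
    · intro K _ x _
      obtain ⟨M, hM⟩ := hbd {(x : E)} isCompact_singleton (singleton_subset_iff.2 x.2)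
      refine ⟨Icc (-M) M, isCompact_Icc, ?_⟩
      rintro _ ⟨n, rfl⟩
      exact abs_le.1 (hM n x rfl)
  obtain ⟨g, -, φ, hφ, hlim⟩ := hcpt.tendsto_subseq fun n => subset_closure (mem_range_self n)
  refine ⟨φ, hφ, fun K hK hKΩ => ?_⟩
  have hK' : IsCompact ((↑) ⁻¹' K : Set Ω) :=
    Topology.IsInducing.subtypeVal.isCompact_preimage' hK (by simpa using hKΩ)
  have h1 := (ContinuousMap.tendsto_iff_forall_isCompact_tendstoUniformlyOn.1 hlim _
    hK').uniformCauchySeqOn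
  rw [Metric.uniformCauchySeqOn_iff] at h1 ⊢
  intro ε hε
  obtain ⟨n₀, h⟩ := h1 ε hε
  exact ⟨n₀, fun m hm n hn x hx => h m hm n hn ⟨x, hKΩ hx⟩ hx⟩

end LocalCompactness


section SemilinearCompactness

variable {N : ℕ}

/-- A locally bounded sequence of solutions of `-Δw = F(w)`, with `F` of class `C¹`, has a
subsequence that converges in `C²_loc`. -/
theorem exists_subseq_tendstoLocallyUniformlyOn_iteratedFDeriv (hN : 2 ≤ N)
    {Ω : Set (EuclideanSpace ℝ (Fin N))} (hΩ : IsOpen Ω) {F : ℝ → ℝ} (hF : ContDiff ℝ 1 F)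
    {w : ℕ → EuclideanSpace ℝ (Fin N) → ℝ} (hw : ∀ n, ContDiffOn ℝ 2 (w n) Ω)
    (hpde : ∀ n, ∀ x ∈ Ω, -lap (w n) x = F (w n x))
    (hbd : ∀ K, IsCompact K → K ⊆ Ω → ∃ M, ∀ n, ∀ x ∈ K, |w n x| ≤ M) :
    ∃ φ : ℕ → ℕ, StrictMono φ ∧ ∃ wlim, ∀ k : ℕ, k ≤ 2 →
      TendstoLocallyUniformlyOn (fun n x => iteratedFDeriv ℝ k (w (φ n)) x)
        (iteratedFDeriv ℝ k wlim) atTop Ω := by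
  have hat : ∀ n, ∀ x ∈ Ω, ContDiffAt ℝ 2 (w n) x := fun n x hx =>
    (hw n).contDiffAt (hΩ.mem_nhds hx)
  have hd1 : ∀ n, ∀ x ∈ Ω, DifferentiableAt ℝ (w n) x := fun n x hx =>
    (hat n x hx).differentiableAt two_ne_zero
  have hd2 : ∀ n, ∀ x ∈ Ω, DifferentiableAt ℝ (fderiv ℝ (w n)) x := fun n x hx =>
    ((hat n x hx).fderiv_right (m := 1) (by norm_num)).differentiableAt one_ne_zero
  have hFd : ∀ s, DifferentiableAt ℝ F s := fun s => hF.differentiable one_ne_zero s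
  have hF' : Continuous (deriv F) := hF.continuous_deriv le_rfl
  have hcb : ∀ {G : ℝ → ℝ}, Continuous G → ∀ K, IsCompact K → K ⊆ Ω →
      ∃ M, ∀ n, ∀ x ∈ K, |G (w n x)| ≤ M := by
    intro G hG K hK hKΩ
    obtain ⟨M, hM⟩ := hbd K hK hKΩ
    obtain ⟨B, hB⟩ := (isCompact_Icc (a := -M) (b := M)).exists_bound_of_continuousOn
      hG.continuousOn
    exact ⟨B, fun n x hx => hB _ (abs_le.1 (hM n x hx))⟩
  have hbd' : ∀ K, IsCompact K → K ⊆ Ω → ∃ M, ∀ n, ∀ x ∈ K, ‖fderiv ℝ (w n) x‖ ≤ M := by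
    intro K hK hKΩ
    obtain ⟨δ, hδ, K', hK', hK'Ω, hsub⟩ := exists_isCompact_closedBall_subset hΩ hK hKΩ
    obtain ⟨C₁, hC₁, h⟩ := exists_norm_fderiv_le_of_lap hN hδ
    obtain ⟨M, hM⟩ := hbd K' hK' hK'Ω
    obtain ⟨B, hB⟩ := hcb hF.continuous K' hK' hK'Ω
    refine ⟨C₁ * max M B, fun n x hx => h Ω (w n) x _ hΩ (hw n) ((hsub x hx).trans hK'Ω)
      (fun y hy => (hM n y (hsub x hx hy)).trans (le_max_left _ _)) fun y hy => ?_⟩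
    rw [← abs_neg, hpde n y (hK'Ω (hsub x hx hy))]
    exact (hB n y (hsub x hx hy)).trans (le_max_right _ _)
  obtain ⟨φ, hφ, hcau⟩ := exists_subseq_uniformCauchySeqOn hΩ hd1 hbd hbd'
  have hcomp : ∀ {G : ℝ → ℝ}, Continuous G → ∀ K, IsCompact K → K ⊆ Ω →
      UniformCauchySeqOn (fun n x => G (w (φ n) x)) atTop K := by
    intro G hG K hK hKΩ
    obtain ⟨M, hM⟩ := hbd K hK hKΩ
    exact (hcau K hK hKΩ).continuous_comp hG fun n => hM (φ n)
  have hlap : ∀ m n, ∀ x ∈ Ω, lap (fun y => w m y - w n y) x = -(F (w m x) - F (w n x)) := by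
    intro m n x hx
    rw [lap_sub (hat m x hx) (hat n x hx), ← hpde m x hx, ← hpde n x hx]
    ring
  have hcau1 : ∀ K, IsCompact K → K ⊆ Ω →
      UniformCauchySeqOn (fun n => fderiv ℝ (w (φ n))) atTop K := by
    intro K hK hKΩ
    obtain ⟨δ, hδ, K', hK', hK'Ω, hsub⟩ := exists_isCompact_closedBall_subset hΩ hK hKΩ
    obtain ⟨C₁, hC₁, h⟩ := exists_norm_fderiv_le_of_lap hN hδ
    refine uniformCauchySeqOn_of_norm_sub_le hC₁ (hcau K' hK' hK'Ω) (hcomp hF.continuous K' hK' hK'Ω)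
      fun m n M h1 h2 x hx => ?_
    rw [← fderiv_fun_sub (hd1 _ x (hKΩ hx)) (hd1 _ x (hKΩ hx))]
    refine h Ω _ x M hΩ ((hw _).sub (hw _)) ((hsub x hx).trans hK'Ω)
      (fun y hy => h1 y (hsub x hx hy)) fun y hy => ?_
    rw [hlap _ _ y (hK'Ω (hsub x hx hy)), abs_neg]
    exact h2 y (hsub x hx hy)
  have hcau2 : ∀ K, IsCompact K → K ⊆ Ω →
      UniformCauchySeqOn (fun n => fderiv ℝ (fderiv ℝ (w (φ n)))) atTop K := by
    intro K hK hKΩ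
    obtain ⟨δ, hδ, K', hK', hK'Ω, hsub⟩ := exists_isCompact_closedBall_subset hΩ hK hKΩ
    obtain ⟨C₁, hC₁, h⟩ := exists_norm_fderiv_fderiv_le_of_lap hN (half_pos hδ)
    obtain ⟨A, hA⟩ := hcb hF' K' hK' hK'Ω
    obtain ⟨B, hB⟩ := hbd' K' hK' hK'Ω
    have hFc : UniformCauchySeqOn (fun n x => deriv F (w (φ n) x) • fderiv ℝ (w (φ n)) x)
        atTop K' :=
      (hcomp hF' K' hK' hK'Ω).smul_of_bounded (hcau1 K' hK' hK'Ω) (fun n => hA (φ n))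
        fun n => hB (φ n)
    refine uniformCauchySeqOn_of_norm_sub_le (A := EuclideanSpace ℝ (Fin N) →L[ℝ] ℝ)
      (B := EuclideanSpace ℝ (Fin N) →L[ℝ] ℝ)
      (D := EuclideanSpace ℝ (Fin N) →L[ℝ] EuclideanSpace ℝ (Fin N) →L[ℝ] ℝ)
      hC₁ (hcau1 K' hK' hK'Ω) hFc fun m n M h1 h2 x hx => ?_
    have hball : closedBall x (2 * (δ / 2)) ⊆ K' := by
      rw [mul_div_cancel₀ δ two_ne_zero]; exact hsub x hx
    have hev : fderiv ℝ (fun y => w (φ m) y - w (φ n) y) =ᶠ[nhds x]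
        fun y => fderiv ℝ (w (φ m)) y - fderiv ℝ (w (φ n)) y := by
      filter_upwards [hΩ.mem_nhds (hKΩ hx)] with y hy
      exact fderiv_fun_sub (hd1 _ y hy) (hd1 _ y hy)
    rw [← fderiv_fun_sub (hd2 _ x (hKΩ hx)) (hd2 _ x (hKΩ hx)), ← hev.fderiv_eq]
    have hFw : ∀ k, ∀ y ∈ Ω, HasFDerivAt (fun z => F (w k z)) (deriv F (w k y) • fderiv ℝ (w k) y)
        y := fun k y hy => (hFd _).hasDerivAt.comp_hasFDerivAt y (hd1 k y hy).hasFDerivAt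
    have hFsub := fun y (hy : y ∈ Ω) => ((hFw (φ m) y hy).fun_sub (hFw (φ n) y hy)).fun_neg
    refine h Ω _ (fun y => -(F (w (φ m) y) - F (w (φ n) y))) x M hΩ ((hw _).sub (hw _))
      (hball.trans hK'Ω) (fun y hy => hlap _ _ y hy) (fun y hy => (hFsub y hy).differentiableAt)
      (fun y hy => ?_) fun y hy => ?_
    · rw [fderiv_fun_sub (hd1 _ y (hK'Ω (hball hy))) (hd1 _ y (hK'Ω (hball hy)))]
      exact h1 y (hball hy)
    · rw [(hFsub y (hK'Ω (hball hy))).fderiv, norm_neg]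
      exact h2 y (hball hy)
  obtain ⟨g0, hg0⟩ := exists_tendstoLocallyUniformlyOn_of_uniformCauchySeqOn hΩ hcau
  obtain ⟨g1, hg1⟩ := exists_tendstoLocallyUniformlyOn_of_uniformCauchySeqOn
    (E := EuclideanSpace ℝ (Fin N) →L[ℝ] ℝ) hΩ hcau1
  obtain ⟨g2, hg2⟩ := exists_tendstoLocallyUniformlyOn_of_uniformCauchySeqOn
    (E := EuclideanSpace ℝ (Fin N) →L[ℝ] EuclideanSpace ℝ (Fin N) →L[ℝ] ℝ) hΩ hcau2
  have e1 : ∀ x ∈ Ω, g1 x = fderiv ℝ g0 x := fun x hx =>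
    (hasFDerivAt_of_tendstoLocallyUniformlyOn hΩ hg1
      (fun n y hy => (hd1 (φ n) y hy).hasFDerivAt) (fun y hy => hg0.tendsto_at hy) hx).fderiv.symm
  have e2 : ∀ x ∈ Ω, g2 x = fderiv ℝ (fderiv ℝ g0) x := by
    intro x hx
    have h1 : g1 =ᶠ[nhds x] fderiv ℝ g0 := by
      filter_upwards [hΩ.mem_nhds hx] with y hy using e1 y hy
    rw [← h1.fderiv_eq]
    exact (hasFDerivAt_of_tendstoLocallyUniformlyOn hΩ hg2
      (fun n y hy => (hd2 (φ n) y hy).hasFDerivAt) (fun y hy => hg1.tendsto_at hy) hx).fderiv.symm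
  refine ⟨φ, hφ, g0, fun k hk => ?_⟩
  interval_cases k
  · exact tendstoLocallyUniformlyOn_iteratedFDeriv_zero hg0
  · exact tendstoLocallyUniformlyOn_iteratedFDeriv_succ
      (tendstoLocallyUniformlyOn_iteratedFDeriv_zero (hg1.congr_right e1))
  · exact tendstoLocallyUniformlyOn_iteratedFDeriv_succ
      (tendstoLocallyUniformlyOn_iteratedFDeriv_succ
        (tendstoLocallyUniformlyOn_iteratedFDeriv_zero (hg2.congr_right e2)))

/-- Functions with nonpositive Laplacian and bounded integral of the negative part are locally
bounded from below. -/
theorem exists_negPart_le_of_lap_nonpos (hN : 2 ≤ N) {Ω K : Set (EuclideanSpace ℝ (Fin N))}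
    (hΩ : IsOpen Ω) (hK : IsCompact K) (hKΩ : K ⊆ Ω) {C : ℝ} (hC : 0 ≤ C) :
    ∃ M, 0 ≤ M ∧ ∀ w : EuclideanSpace ℝ (Fin N) → ℝ, ContDiffOn ℝ 2 w Ω →
      (∀ x ∈ Ω, lap w x ≤ 0) → IntegrableOn (fun x => max (-(w x)) 0) Ω →
      (∫ x in Ω, max (-(w x)) 0) ≤ C → ∀ x ∈ K, max (-(w x)) 0 ≤ M := by
  obtain ⟨δ, hδ, K', -, hK'Ω, hsub⟩ := exists_isCompact_closedBall_subset hΩ hK hKΩ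
  obtain ⟨C₀, hC₀, hmean⟩ := exists_le_mean_add_of_lap_ge hN
  refine ⟨C₀ * ((δ ^ N)⁻¹ * C), by positivity, fun w hw hlap hInt hle x hx => ?_⟩
  have hball : closedBall x δ ⊆ Ω := (hsub x hx).trans hK'Ω
  have h := hmean Ω (fun y => -w y) x δ 0 hΩ hw.neg hδ hball le_rfl fun y hy => by
    rw [lap_neg]; linarith [hlap y (hball hy)]
  have h1 : ∫ y in closedBall x δ, max (-w y) 0 ≤ C :=
    (setIntegral_mono_set hInt (Eventually.of_forall fun y => le_max_right _ _)
      hball.eventuallyLE).trans hle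
  refine max_le ?_ (by positivity)
  have h2 : C₀ * ((δ ^ N)⁻¹ * ∫ y in closedBall x δ, max (-w y) 0) ≤ C₀ * ((δ ^ N)⁻¹ * C) := by
    gcongr
  linarith

end SemilinearCompactness

/-- Theorem 6.1 (Brezis–Merle type): for solutions of `-Δw_n = [w_n-1]₊ᵖ` in an open set
`Ω ⊆ ℝᴺ`, `N ≥ 2`, `1 < p < p_N`, with uniformly `L¹`-bounded negative parts, the negative
parts are locally uniformly bounded and along a subsequence either `w_n → +∞` locally
uniformly, or `w_n → w` in `C²_loc(Ω)`; the latter occurs iff `[w_n-1]₊ᵖ` is bounded in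
`L¹_loc(Ω)`. -/
theorem statement9 (N : ℕ) (hN : 2 ≤ N) (Ω : Set (EuclideanSpace ℝ (Fin N)))
    (hopen : IsOpen Ω)
    (p : ℝ) (hp : 1 < p) (hpN : 2 < N → p < (N : ℝ) / ((N : ℝ) - 2))
    (C : ℝ) (w : ℕ → EuclideanSpace ℝ (Fin N) → ℝ)
    (hsmooth : ∀ n, ContDiffOn ℝ 2 (w n) Ω)
    (hpde : ∀ n, ∀ x ∈ Ω, -lap (w n) x = max (w n x - 1) 0 ^ p)
    (hnegint : ∀ n, IntegrableOn (fun x => max (-(w n x)) 0) Ω)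
    (hneg : ∀ n, (∫ x in Ω, max (-(w n x)) 0) ≤ C) :
    (∀ K, IsCompact K → K ⊆ Ω → ∃ M : ℝ, ∀ n, ∀ x ∈ K, max (-(w n x)) 0 ≤ M) ∧
    ∃ φ : ℕ → ℕ, StrictMono φ ∧
      ((∀ K, IsCompact K → K ⊆ Ω → ∀ M : ℝ, ∀ᶠ n in atTop, ∀ x ∈ K, M ≤ w (φ n) x) ∨
        (∃ wlim, ∀ k : ℕ, k ≤ 2 →
          TendstoLocallyUniformlyOn (fun n x => iteratedFDeriv ℝ k (w (φ n)) x)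
            (iteratedFDeriv ℝ k wlim) atTop Ω)) ∧
      ((∃ wlim, ∀ k : ℕ, k ≤ 2 →
          TendstoLocallyUniformlyOn (fun n x => iteratedFDeriv ℝ k (w (φ n)) x)
            (iteratedFDeriv ℝ k wlim) atTop Ω) ↔
        (∀ K, IsCompact K → K ⊆ Ω → ∃ M : ℝ, ∀ n,
          (∫ x in K, max (w (φ n) x - 1) 0 ^ p) ≤ M)) := by
  have hC : 0 ≤ C := (integral_nonneg fun x => le_max_right _ _).trans (hneg 0)
  have hlow : ∀ K, IsCompact K → K ⊆ Ω →
      ∃ M : ℝ, 0 ≤ M ∧ ∀ n, ∀ x ∈ K, max (-(w n x)) 0 ≤ M := by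
    intro K hK hKΩ
    obtain ⟨M, hM0, hM⟩ := exists_negPart_le_of_lap_nonpos hN hopen hK hKΩ hC
    refine ⟨M, hM0, fun n => hM (w n) (hsmooth n) (fun x hx => ?_) (hnegint n) (hneg n)⟩
    have h1 : 0 ≤ max (w n x - 1) 0 ^ p := rpow_nonneg (le_max_right _ _) _
    linarith [hpde n x hx]
  have hInt : ∀ K, IsCompact K → K ⊆ Ω →
      ∃ L : ℝ, ∀ n, (∫ x in K, max (w n x - 1) 0 ^ p) ≤ L := by
    intro K hK hKΩ
    obtain ⟨K', hK', hK'Ω, h⟩ := exists_setIntegral_rpow_le hopen hK hKΩ hp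
    obtain ⟨M₀, hM₀, hM⟩ := hlow K' hK' hK'Ω
    obtain ⟨L, hL⟩ := h M₀ hM₀
    exact ⟨L, fun n => hL (w n) (hsmooth n) (hpde n) fun x hx => by
      linarith [hM n x hx, le_max_left (-(w n x)) 0]⟩
  have hbd : ∀ K, IsCompact K → K ⊆ Ω → ∃ M, ∀ n, ∀ x ∈ K, |w n x| ≤ M := by
    intro K hK hKΩ
    obtain ⟨δ, hδ, K', hK', hK'Ω, hsub⟩ := exists_isCompact_closedBall_subset hopen hK hKΩ
    obtain ⟨L, hL⟩ := hInt K' hK' hK'Ω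
    obtain ⟨M₀, -, hM₀⟩ := hlow K hK hKΩ
    obtain ⟨M, hM⟩ := exists_le_of_setIntegral_rpow_le hN hp hpN hδ (le_max_right L 0)
    refine ⟨max M M₀, fun n x hx => abs_le'.2 ⟨?_, ?_⟩⟩
    · refine (hM Ω (w n) x hopen (hsmooth n) (hpde n) ((hsub x hx).trans hK'Ω) ?_ x
        (mem_closedBall_self (by positivity))).trans (le_max_left _ _)
      have hc : ContinuousOn (fun y => max (w n y - 1) 0 ^ p) K' :=
        ((((hsmooth n).continuousOn.mono hK'Ω).sub continuousOn_const).sup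
          continuousOn_const).rpow_const fun _ _ => Or.inr (by linarith)
      exact ((setIntegral_mono_set (hc.integrableOn_compact hK')
        (Eventually.of_forall fun y => rpow_nonneg (le_max_right _ _) _)
        (hsub x hx).eventuallyLE).trans (hL n)).trans (le_max_left _ _)
    · exact ((le_max_left _ _).trans (hM₀ n x hx)).trans (le_max_right _ _)
  obtain ⟨φ, hφ, hlim⟩ := exists_subseq_tendstoLocallyUniformlyOn_iteratedFDeriv hN hopen
    (contDiff_one_max_sub_one_rpow hp) hsmooth hpde hbd
  refine ⟨fun K hK hKΩ => ?_, φ, hφ, Or.inr hlim, fun _ K hK hKΩ => ?_, fun _ => hlim⟩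
  · obtain ⟨M, -, hM⟩ := hlow K hK hKΩ
    exact ⟨M, hM⟩
  · obtain ⟨L, hL⟩ := hInt K hK hKΩ
    exact ⟨L, fun n => hL (φ n)⟩
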